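/- Suppose that (QIA_∞) holds. Then for every prime p and every non-negative function ψ : ℕ → ℝ, one has μ_p(W_p(ψ)) = 1 if Σ_{n∈ℕ} μ_p(E_n(ψ)) = ∞, and μ_p(W_p(ψ)) = 0 otherwise. -/

import Mathlib

open MeasureTheory Filter

noncomputable section

/-- The set `E_n(ψ) ⊆ ℤ_p`: union over integers `a` with `|a| ≤ n`, `gcd(a,n) = 1`
of the closed balls `{x : |x - a/n|_p ≤ ψ(n)}`. -/
def padicE (p : ℕ) [Fact p.Prime] (ψ : ℕ → ℝ) (n : ℕ) : Set ℤ_[p] :=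
  {x | ∃ a : ℤ, |a| ≤ (n : ℤ) ∧ Int.gcd a n = 1 ∧
    ‖(x : ℚ_[p]) - (a : ℚ_[p]) / (n : ℚ_[p])‖ ≤ ψ n}

/-- `W_p(ψ)`: the points of `ℤ_p` lying in infinitely many of the sets `E_n(ψ)`. -/
def padicW (p : ℕ) [Fact p.Prime] (ψ : ℕ → ℝ) : Set ℤ_[p] :=
  {x | {n : ℕ | x ∈ padicE p ψ n}.Infinite}

/-- The set `A_n(ψ) ⊆ ℝ/ℤ`: union over `1 ≤ a ≤ n`, `gcd(a,n) = 1` of the closed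
intervals `[a/n - ψ(n), a/n + ψ(n)]` taken mod 1. -/
def circleA (ψ : ℕ → ℝ) (n : ℕ) : Set UnitAddCircle :=
  {x | ∃ a : ℕ, 1 ≤ a ∧ a ≤ n ∧ Nat.gcd a n = 1 ∧
    ‖x - (((a : ℝ) / (n : ℝ) : ℝ) : UnitAddCircle)‖ ≤ ψ n}

/-- `(QIA_∞)` holds: quasi-independence on average holds in `ℝ/ℤ` for every
non-negative `ψ` with divergent sum of measures. -/
def QIAinftyHolds : Prop :=
  ∀ ψ : ℕ → ℝ, (∀ n, 0 ≤ ψ n) → (∑' n : ℕ, volume (circleA ψ n)) = ⊤ →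
    0 < atTop.limsup (fun N : ℕ =>
      (∑ n ∈ Finset.Icc 1 N, volume (circleA ψ n)) ^ 2 /
        ∑ m ∈ Finset.Icc 1 N, ∑ n ∈ Finset.Icc 1 N, volume (circleA ψ m ∩ circleA ψ n))

section Sieve

lemma sum_range_mul_of_periodic {Q : ℕ} {G : ℕ → ℝ} (hG : Function.Periodic G Q) (w : ℕ) :
    ∑ c ∈ Finset.range (Q * w), G c = w * ∑ c ∈ Finset.range Q, G c := by
  induction w with
  | zero => simp
  | succ w ih =>
    rw [Nat.mul_succ, Finset.sum_range_add, ih]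
    have : ∀ x, G (Q * w + x) = G x := fun x => by
      have := (hG.nat_mul w) x
      rw [← this, add_comm]
      simp [mul_comm]
    simp only [this]
    push_cast
    ring

lemma sum_range_mul_mul_of_periodic {Q q : ℕ} (hQ : 0 < Q) (hq : 0 < q) (h : Nat.Coprime Q q)
    {A B : ℕ → ℝ} (hA : Function.Periodic A Q) (hB : Function.Periodic B q) :
    ∑ c ∈ Finset.range (Q * q), A c * B c =
      (∑ c ∈ Finset.range Q, A c) * ∑ c ∈ Finset.range q, B c := by
  rw [Finset.sum_mul_sum, ← Finset.sum_product']
  refine Finset.sum_nbij' (fun c => (c % Q, c % q))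
    (fun x => (Nat.chineseRemainder h x.1 x.2 : ℕ)) ?_ ?_ ?_ ?_ ?_
  · intro c _
    simp [Nat.mod_lt _ hQ, Nat.mod_lt _ hq]
  · intro x _
    simpa using Nat.chineseRemainder_lt_mul h x.1 x.2 hQ.ne' hq.ne'
  · intro c hc
    have h1 := Nat.chineseRemainder_modEq_unique h (a := c % Q) (b := c % q) (z := c)
      (Nat.mod_modEq _ _).symm (Nat.mod_modEq _ _).symm
    have h2 := Nat.chineseRemainder_lt_mul h (c % Q) (c % q) hQ.ne' hq.ne'
    simp only [Finset.mem_range] at hc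
    exact (Nat.ModEq.eq_of_lt_of_lt h1 hc h2).symm
  · rintro ⟨a, b⟩ hx
    simp only [Finset.mem_product, Finset.mem_range] at hx
    have := (Nat.chineseRemainder h a b).2
    ext
    · exact Nat.ModEq.eq_of_lt_of_lt ((Nat.mod_modEq _ _).trans this.1) (Nat.mod_lt _ hQ) hx.1
    · exact Nat.ModEq.eq_of_lt_of_lt ((Nat.mod_modEq _ _).trans this.2) (Nat.mod_lt _ hq) hx.2
  · intro c _
    simp [hA.map_mod_nat, hB.map_mod_nat]

lemma periodic_prod_primes {P : Finset ℕ} {f : ℕ → ℕ → ℝ}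
    (hf : ∀ q ∈ P, Function.Periodic (f q) q) :
    Function.Periodic (fun c => ∏ q ∈ P, f q c) (∏ q ∈ P, q) := by
  intro c
  refine Finset.prod_congr rfl fun q hq => ?_
  obtain ⟨k, hk⟩ := Finset.dvd_prod_of_mem (fun q : ℕ => q) hq
  have := (hf q hq).nat_mul k c
  rw [hk]
  simpa [mul_comm] using this

lemma sum_range_prod_primes {P : Finset ℕ} (hP : ∀ q ∈ P, q.Prime) {f : ℕ → ℕ → ℝ}
    (hf : ∀ q ∈ P, Function.Periodic (f q) q) :
    ∑ c ∈ Finset.range (∏ q ∈ P, q), ∏ q ∈ P, f q c =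
      ∏ q ∈ P, ∑ u ∈ Finset.range q, f q u := by
  classical
  induction P using Finset.induction_on with
  | empty => simp
  | insert q P hq ih =>
    have hP' : ∀ r ∈ P, r.Prime := fun r hr => hP r (Finset.mem_insert_of_mem hr)
    have hf' : ∀ r ∈ P, Function.Periodic (f r) r := fun r hr =>
      hf r (Finset.mem_insert_of_mem hr)
    have hqp : q.Prime := hP q (Finset.mem_insert_self _ _)
    simp only [Finset.prod_insert hq]
    rw [← ih hP' hf']
    refine sum_range_mul_mul_of_periodic hqp.pos
      (Finset.prod_pos fun r hr => (hP' r hr).pos) ?_ (hf q (Finset.mem_insert_self _ _))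
      (periodic_prod_primes hf')
    refine Nat.Coprime.prod_right fun r hr => ?_
    refine (Nat.coprime_primes hqp (hP' r hr)).2 ?_
    rintro rfl
    exact hq hr

/-- `∏_{q ∣ n} (1 - 1/q) = φ(n)/n`. -/
def eulerDensity (n : ℕ) : ℝ := ∏ q ∈ n.primeFactors, (1 - (q : ℝ)⁻¹)

lemma totient_eq_mul_eulerDensity (n : ℕ) : (n.totient : ℝ) = n * eulerDensity n := by
  have := Nat.totient_eq_mul_prod_factors n
  have h2 : ((n.totient : ℚ) : ℝ) = ((n * ∏ p ∈ n.primeFactors, (1 - (p : ℚ)⁻¹) : ℚ) : ℝ) := by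
    rw [this]
  push_cast at h2
  exact h2

lemma one_sub_inv_prime_pos {q : ℕ} (hq : q.Prime) : 0 < 1 - (q : ℝ)⁻¹ := by
  have : (2 : ℝ) ≤ q := by exact_mod_cast hq.two_le
  have := inv_anti₀ (by norm_num) this
  linarith

lemma eulerDensity_pos (n : ℕ) : 0 < eulerDensity n :=
  Finset.prod_pos fun _ hq => one_sub_inv_prime_pos (Nat.prime_of_mem_primeFactors hq)

lemma two_pow_card_primeFactors_le {n : ℕ} (hn : n ≠ 0) : 2 ^ n.primeFactors.card ≤ n := by
  calc 2 ^ n.primeFactors.card = ∏ _q ∈ n.primeFactors, 2 := by simp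
    _ ≤ ∏ q ∈ n.primeFactors, q :=
      Finset.prod_le_prod' fun q hq => (Nat.prime_of_mem_primeFactors hq).two_le
    _ ≤ n := Nat.le_of_dvd (Nat.pos_of_ne_zero hn) (Nat.prod_primeFactors_dvd n)

/-- Prime factors of `n` exceeding `y` contribute boundedly when `n < 4 ^ (j * (y + 1))`. -/
lemma prod_large_primeFactors_le {n y j : ℕ} (hn : n ≠ 0) (hny : n < 4 ^ (j * (y + 1))) :
    ∏ q ∈ n.primeFactors with y < q, (1 - (q : ℝ)⁻¹)⁻¹ ≤ Real.exp (4 * j) := by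
  have hy : (0 : ℝ) < y + 1 := by positivity
  have h1 : ∀ q ∈ n.primeFactors.filter (y < ·),
      (1 - (q : ℝ)⁻¹)⁻¹ ≤ Real.exp (2 / (y + 1)) := by
    intro q hq
    rw [Finset.mem_filter] at hq
    have hqp := Nat.prime_of_mem_primeFactors hq.1
    have h2 : (2 : ℝ) ≤ q := by exact_mod_cast hqp.two_le
    have h3 : (y + 1 : ℝ) ≤ q := by exact_mod_cast hq.2
    have h4 : (1 - (q : ℝ)⁻¹)⁻¹ = 1 + 1 / (q - 1) := by
      have : (q : ℝ) - 1 ≠ 0 := by linarith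
      field_simp
      ring
    rw [h4]
    have h5 : 1 / ((q : ℝ) - 1) ≤ 2 / (y + 1) := by
      rw [div_le_div_iff₀ (by linarith) hy]
      linarith
    linarith [Real.add_one_le_exp (2 / ((y : ℝ) + 1))]
  have hcard : ((n.primeFactors.filter (y < ·)).card : ℝ) ≤ 2 * (j * (y + 1)) := by
    have a1 := two_pow_card_primeFactors_le hn
    have a2 : 2 ^ n.primeFactors.card < 2 ^ (2 * (j * (y + 1))) := by
      rw [pow_mul 2 2]
      exact lt_of_le_of_lt a1 hny
    have a3 := (Nat.pow_lt_pow_iff_right (by norm_num : 1 < 2)).1 a2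
    have a4 := Finset.card_filter_le n.primeFactors (y < ·)
    exact_mod_cast (a4.trans a3.le)
  calc ∏ q ∈ n.primeFactors with y < q, (1 - (q : ℝ)⁻¹)⁻¹
      ≤ ∏ _q ∈ n.primeFactors with y < _q, Real.exp (2 / (y + 1)) :=
        Finset.prod_le_prod (fun q hq => (inv_pos.2 (one_sub_inv_prime_pos
          (Nat.prime_of_mem_primeFactors (Finset.mem_filter.1 hq).1))).le) h1
    _ = Real.exp ((n.primeFactors.filter (y < ·)).card * (2 / (y + 1))) := by
        rw [Finset.prod_const, ← Real.exp_nat_mul]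
    _ ≤ Real.exp (4 * j) := by
        refine Real.exp_le_exp.2 ?_
        calc _ ≤ (2 * (j * (y + 1))) * (2 / ((y : ℝ) + 1)) := by gcongr
          _ = 4 * j := by field_simp; ring

lemma prod_one_add_inv_primes_le (y : ℕ) :
    ∏ q ∈ y.primesLE, (1 + 1 / ((q : ℝ) * (q - 1))) ≤ Real.exp 1 := by
  have h1 : ∑ q ∈ y.primesLE, 1 / ((q : ℝ) * (q - 1)) ≤ 1 := by
    have h2 : ∀ z : ℕ, ∑ q ∈ Finset.Icc 2 (z + 1), 1 / ((q : ℝ) * (q - 1)) = 1 - 1 / (z + 1) := by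
      intro z
      induction z with
      | zero => simp
      | succ z ih =>
        rw [Finset.sum_Icc_succ_top (by omega), ih]
        push_cast
        have : (z : ℝ) + 1 ≠ 0 := by positivity
        have : (z : ℝ) + 1 + 1 ≠ 0 := by positivity
        have : (z : ℝ) + 1 + 1 - 1 ≠ 0 := by ring_nf; positivity
        field_simp
        ring
    calc _ ≤ ∑ q ∈ Finset.Icc 2 (y + 1), 1 / ((q : ℝ) * (q - 1)) := by
          refine Finset.sum_le_sum_of_subset_of_nonneg ?_ ?_
          · intro q hq
            rw [Nat.mem_primesLE] at hq
            rw [Finset.mem_Icc]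
            exact ⟨hq.2.two_le, by omega⟩
          · intro q hq _
            have : (2 : ℝ) ≤ q := by exact_mod_cast (Finset.mem_Icc.1 hq).1
            exact div_nonneg zero_le_one (mul_nonneg (by linarith) (by linarith))
      _ ≤ 1 := by
          rw [h2]
          have : (0 : ℝ) ≤ 1 / ((y : ℝ) + 1) := by positivity
          linarith
  calc _ ≤ ∏ q ∈ y.primesLE, Real.exp (1 / ((q : ℝ) * (q - 1))) := by
        refine Finset.prod_le_prod ?_ ?_
        · intro q hq
          have : (2 : ℝ) ≤ q := by exact_mod_cast (Nat.mem_primesLE.1 hq).2.two_le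
          have := div_nonneg zero_le_one
            (mul_nonneg (by linarith : (0 : ℝ) ≤ q) (by linarith : (0 : ℝ) ≤ (q : ℝ) - 1))
          linarith
        · intro q _
          linarith [Real.add_one_le_exp (1 / ((q : ℝ) * (q - 1)))]
    _ = Real.exp (∑ q ∈ y.primesLE, 1 / ((q : ℝ) * (q - 1))) := (Real.exp_sum _ _).symm
    _ ≤ _ := Real.exp_le_exp.2 h1

lemma prod_primeFactors_le_small_mul {n y j : ℕ} (hn : n ≠ 0) (hny : n < 4 ^ (j * (y + 1))) :
    ∏ q ∈ n.primeFactors, (1 - (q : ℝ)⁻¹)⁻¹ ≤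
      Real.exp (4 * j) * ∏ q ∈ y.primesLE with q ∣ n, (1 - (q : ℝ)⁻¹)⁻¹ := by
  rw [← Finset.prod_filter_mul_prod_filter_not n.primeFactors (y < ·)]
  have : n.primeFactors.filter (fun q => ¬ y < q) = y.primesLE.filter (· ∣ n) := by
    ext q
    simp only [Finset.mem_filter, Nat.mem_primeFactors, Nat.mem_primesLE, not_lt]
    tauto
  rw [this]
  refine mul_le_mul_of_nonneg_right (prod_large_primeFactors_le hn hny) ?_
  refine Finset.prod_nonneg fun q hq => (inv_pos.2 (one_sub_inv_prime_pos ?_)).le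
  exact (Nat.mem_primesLE.1 (Finset.mem_filter.1 hq).1).2

lemma prod_small_primes_le_eulerDensity {M y j : ℕ} (hM : M ≠ 0)
    (hMy : M < 4 ^ (j * (y + 1))) :
    ∏ q ∈ y.primesLE with q ∣ M, (1 - (q : ℝ)⁻¹) ≤ Real.exp (4 * j) * eulerDensity M := by
  have h := prod_primeFactors_le_small_mul hM hMy
  have hpos : 0 < ∏ q ∈ y.primesLE with q ∣ M, (1 - (q : ℝ)⁻¹) :=
    Finset.prod_pos fun q hq =>
      one_sub_inv_prime_pos (Nat.mem_primesLE.1 (Finset.mem_filter.1 hq).1).2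
  rw [Finset.prod_inv_distrib, Finset.prod_inv_distrib] at h
  change (eulerDensity M)⁻¹ ≤ _ at h
  have h2 := eulerDensity_pos M
  rw [← div_eq_mul_inv, le_div_iff₀ hpos, inv_mul_le_iff₀ h2] at h
  linarith

/-- The factor at the prime `q` of the weight `1_{gcd(c, M) = 1} c / φ(c)`. -/
def sieveWeight (M q c : ℕ) : ℝ :=
  if q ∣ c then (if q ∣ M then 0 else (1 - (q : ℝ)⁻¹)⁻¹) else 1

lemma sieveWeight_periodic (M q : ℕ) : Function.Periodic (sieveWeight M q) q := by
  intro c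
  simp [sieveWeight]

lemma sieveWeight_nonneg {M q c : ℕ} (hq : q.Prime) : 0 ≤ sieveWeight M q c := by
  have := inv_pos.2 (one_sub_inv_prime_pos hq)
  unfold sieveWeight
  split_ifs <;> linarith

lemma sum_sieveWeight {M q : ℕ} (hq : q.Prime) :
    ∑ u ∈ Finset.range q, sieveWeight M q u ≤
      q * ((if q ∣ M then (1 - (q : ℝ)⁻¹) else 1) * (1 + 1 / ((q : ℝ) * (q - 1)))) := by
  obtain ⟨r, rfl⟩ := Nat.exists_eq_succ_of_ne_zero hq.ne_zero
  have h1 : ∀ u ∈ Finset.range r, sieveWeight M (r + 1) (u + 1) = 1 := by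
    intro u hu
    rw [Finset.mem_range] at hu
    unfold sieveWeight
    rw [if_neg]
    exact Nat.not_dvd_of_pos_of_lt (Nat.succ_pos _) (by omega)
  rw [Finset.sum_range_succ', Finset.sum_congr rfl h1]
  have hr : (1 : ℝ) ≤ r := by
    have := hq.two_le
    exact_mod_cast (by omega : 1 ≤ r)
  simp only [sieveWeight, dvd_zero, if_true, Finset.sum_const, Finset.card_range, nsmul_eq_mul,
    mul_one, Nat.succ_eq_add_one]
  push_cast
  have hr0 : (r : ℝ) ≠ 0 := by linarith
  have hr1 : (r : ℝ) + 1 ≠ 0 := by linarith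
  split_ifs
  · have : (r + 1 : ℝ) * ((1 - ((r : ℝ) + 1)⁻¹) * (1 + 1 / (((r : ℝ) + 1) * (r + 1 - 1)))) =
        r + 1 / (r + 1) := by
      rw [add_sub_cancel_right]
      field_simp
      ring
    rw [this]
    have : (0 : ℝ) ≤ 1 / (r + 1) := by positivity
    linarith
  · rw [add_sub_cancel_right]
    apply le_of_eq
    have : 1 - ((r : ℝ) + 1)⁻¹ = r / (r + 1) := by field_simp; ring
    rw [this]
    field_simp
    ring

/-- Upper bound sieve for the average of `c / φ(c)` over `c` coprime to `M ≤ X ^ 2`. -/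
lemma sum_coprime_inv_density_le {M X : ℕ} (hM : M ≠ 0) (hX : X ≠ 0) (hMX : M ≤ X ^ 2) :
    ∑ c ∈ Finset.Icc 1 X with Nat.Coprime c M, ∏ q ∈ c.primeFactors, (1 - (q : ℝ)⁻¹)⁻¹ ≤
      2 * Real.exp 13 * X * eulerDensity M := by
  set y := Nat.log 4 X with hy
  have hy1 : 4 ^ y ≤ X := Nat.pow_log_le_self 4 hX
  have hy2 : X < 4 ^ (y + 1) := Nat.lt_pow_succ_log_self (by norm_num) X
  have hM2 : M < 4 ^ (2 * (y + 1)) := by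
    calc M ≤ X ^ 2 := hMX
      _ < (4 ^ (y + 1)) ^ 2 := Nat.pow_lt_pow_left hy2 (by norm_num)
      _ = _ := by rw [← pow_mul]; ring_nf
  have hprime : ∀ q ∈ y.primesLE, q.Prime := fun q hq => (Nat.mem_primesLE.1 hq).2
  set G : ℕ → ℝ := fun c => ∏ q ∈ y.primesLE, sieveWeight M q c with hG
  have hG0 : ∀ c, 0 ≤ G c := fun c =>
    Finset.prod_nonneg fun q hq => sieveWeight_nonneg (hprime q hq)
  have hGp : Function.Periodic G (∏ q ∈ y.primesLE, q) :=
    periodic_prod_primes fun q _ => sieveWeight_periodic M q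
  have hterm : ∀ c ∈ (Finset.Icc 1 X).filter (Nat.Coprime · M),
      ∏ q ∈ c.primeFactors, (1 - (q : ℝ)⁻¹)⁻¹ ≤ Real.exp 4 * G c := by
    intro c hc
    rw [Finset.mem_filter, Finset.mem_Icc] at hc
    have h1 := prod_primeFactors_le_small_mul (n := c) (y := y) (j := 1) (by omega)
      (by rw [one_mul]; omega)
    refine h1.trans (le_of_eq ?_)
    push_cast
    rw [mul_one, Finset.prod_filter]
    congr 1
    refine Finset.prod_congr rfl fun q hq => ?_
    unfold sieveWeight
    by_cases hqc : q ∣ c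
    · have : ¬ q ∣ M := fun hqM =>
        (hprime q hq).one_lt.ne' (Nat.dvd_one.1 (hc.2 ▸ Nat.dvd_gcd hqc hqM))
      simp [hqc, this]
    · simp [hqc]
  set Q := ∏ q ∈ y.primesLE, q with hQ
  have hQ0 : 0 < Q := Finset.prod_pos fun q hq => (hprime q hq).pos
  have hQX : Q ≤ X := (primorial_le_four_pow y).trans hy1
  have hsum : ∑ c ∈ Finset.range Q, G c ≤
      Q * (Real.exp 8 * eulerDensity M * Real.exp 1) := by
    rw [hQ, sum_range_prod_primes hprime fun q _ => sieveWeight_periodic M q]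
    calc _ ≤ ∏ q ∈ y.primesLE, ((q : ℝ) * ((if q ∣ M then (1 - (q : ℝ)⁻¹) else 1) *
            (1 + 1 / ((q : ℝ) * (q - 1))))) :=
          Finset.prod_le_prod (fun q hq => Finset.sum_nonneg fun u _ =>
            sieveWeight_nonneg (hprime q hq)) fun q hq => sum_sieveWeight (hprime q hq)
      _ = (∏ q ∈ y.primesLE, (q : ℝ)) * ((∏ q ∈ y.primesLE with q ∣ M, (1 - (q : ℝ)⁻¹)) *
            ∏ q ∈ y.primesLE, (1 + 1 / ((q : ℝ) * (q - 1)))) := by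
          rw [Finset.prod_mul_distrib, Finset.prod_mul_distrib, Finset.prod_filter]
      _ ≤ _ := by
          push_cast
          have h1 := prod_small_primes_le_eulerDensity hM hM2
          have h2 := prod_one_add_inv_primes_le y
          have h3 : (4 : ℝ) * (2 : ℕ) = 8 := by norm_num
          rw [h3] at h1
          have h4 := (mul_pos (Real.exp_pos 8) (eulerDensity_pos M)).le
          refine mul_le_mul_of_nonneg_left (mul_le_mul h1 h2 ?_ h4) (by positivity)
          refine Finset.prod_nonneg fun q hq => ?_
          have : (2 : ℝ) ≤ q := by exact_mod_cast (hprime q hq).two_le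
          have := div_nonneg zero_le_one
            (mul_nonneg (by linarith : (0 : ℝ) ≤ q) (by linarith : (0 : ℝ) ≤ (q : ℝ) - 1))
          linarith
  have hw : ((X / Q + 1 : ℕ) : ℝ) * Q ≤ 2 * X := by
    have h1 : X / Q * Q ≤ X := Nat.div_mul_le_self X Q
    have : (X / Q + 1) * Q ≤ 2 * X := by rw [add_mul]; omega
    exact_mod_cast this
  have hE : (0 : ℝ) ≤ Real.exp 8 * eulerDensity M * Real.exp 1 :=
    mul_nonneg (mul_pos (Real.exp_pos 8) (eulerDensity_pos M)).le (Real.exp_pos 1).le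
  calc _ ≤ ∑ c ∈ Finset.Icc 1 X with Nat.Coprime c M, Real.exp 4 * G c :=
        Finset.sum_le_sum hterm
    _ ≤ ∑ c ∈ Finset.range (Q * (X / Q + 1)), Real.exp 4 * G c := by
        refine Finset.sum_le_sum_of_subset_of_nonneg ?_ fun c _ _ =>
          mul_nonneg (Real.exp_pos 4).le (hG0 c)
        intro c hc
        rw [Finset.mem_filter, Finset.mem_Icc] at hc
        rw [Finset.mem_range]
        exact lt_of_le_of_lt hc.1.2 (Nat.lt_mul_div_succ X hQ0)
    _ = Real.exp 4 * (((X / Q + 1 : ℕ) : ℝ) * ∑ c ∈ Finset.range Q, G c) := by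
        rw [← Finset.mul_sum, sum_range_mul_of_periodic hGp]
    _ ≤ Real.exp 4 * (((X / Q + 1 : ℕ) : ℝ) *
          (Q * (Real.exp 8 * eulerDensity M * Real.exp 1))) := by gcongr
    _ = Real.exp 4 * ((((X / Q + 1 : ℕ) : ℝ) * Q) *
          (Real.exp 8 * eulerDensity M * Real.exp 1)) := by ring
    _ ≤ Real.exp 4 * ((2 * X) * (Real.exp 8 * eulerDensity M * Real.exp 1)) := by gcongr
    _ = 2 * (Real.exp 4 * Real.exp 8 * Real.exp 1) * X * eulerDensity M := by ring
    _ = _ := by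
        rw [← Real.exp_add, ← Real.exp_add]
        norm_num

end Sieve

section PairCount

/-- The integers `|a| ≤ n` coprime to `n`. -/
def reducedNumerators (n : ℕ) : Finset ℤ :=
  {a ∈ Finset.Icc (-(n : ℤ)) n | Int.gcd a n = 1}

lemma mem_reducedNumerators {n : ℕ} {a : ℤ} :
    a ∈ reducedNumerators n ↔ |a| ≤ (n : ℤ) ∧ Int.gcd a n = 1 := by
  simp [reducedNumerators, abs_le]

lemma totient_le_card_reducedNumerators {n : ℕ} : n.totient ≤ (reducedNumerators n).card := by
  rw [Nat.totient_eq_card_coprime]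
  refine Finset.card_le_card_of_injOn (fun a : ℕ => (a : ℤ)) ?_ ?_
  · intro a ha
    simp only [Finset.coe_filter, Finset.mem_range, Set.mem_ofPred_eq] at ha
    rw [Finset.mem_coe, mem_reducedNumerators]
    refine ⟨?_, ?_⟩
    · rw [abs_of_nonneg (by positivity)]
      exact Int.ofNat_le.2 ha.1.le
    · rw [Int.gcd_natCast_natCast]
      exact ha.2.symm
  · intro a _ b _ h
    exact Int.ofNat_inj.1 h

/-- The number of pairs of reduced numerators for which `a / m` and `b / n` are
`p`-adically within `p ^ (-l)` of each other. -/
def closePairs (p l m n : ℕ) : Finset (ℤ × ℤ) :=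
  {x ∈ reducedNumerators m ×ˢ reducedNumerators n | (p : ℤ) ^ l ∣ x.1 * n - x.2 * m}

/-- Pairs of reduced numerators for `g * u`, `g * v` with prescribed `a * v - b * u`. -/
def pairsWithDet (g u v : ℕ) (e : ℤ) : Finset (ℤ × ℤ) :=
  {x ∈ reducedNumerators (g * u) ×ˢ reducedNumerators (g * v) | x.1 * v - x.2 * u = e}

lemma exists_lt_prime_dvd_add_mul {q : ℕ} (hq : q.Prime) (a : ℤ) {u : ℕ} (hu : ¬ q ∣ u) :
    ∃ t < q, (q : ℤ) ∣ a + u * t := by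
  have := Fact.mk hq
  have hu0 : (u : ZMod q) ≠ 0 := by
    rwa [Ne, ZMod.natCast_eq_zero_iff]
  refine ⟨(-(a : ZMod q) / u).val, ZMod.val_lt _, ?_⟩
  rw [← ZMod.intCast_zmod_eq_zero_iff_dvd]
  push_cast
  rw [ZMod.natCast_zmod_val]
  field_simp
  ring

lemma sum_range_le_sub_one {q : ℕ} {f : ℕ → ℝ} (hf : ∀ t, f t ≤ 1) {t₀ : ℕ} (ht : t₀ < q)
    (h0 : f t₀ = 0) : ∑ t ∈ Finset.range q, f t ≤ q - 1 := by
  rw [← Finset.add_sum_erase _ _ (Finset.mem_range.2 ht), h0, zero_add]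
  refine (Finset.sum_le_card_nsmul _ _ 1 fun t _ => hf t).trans ?_
  rw [Finset.card_erase_of_mem (Finset.mem_range.2 ht), Finset.card_range, nsmul_eq_mul, mul_one,
    Nat.cast_sub (by omega), Nat.cast_one]

lemma sum_range_le_sub_two {q : ℕ} {f : ℕ → ℝ} (hf : ∀ t, f t ≤ 1) {t₀ t₁ : ℕ} (ht : t₀ < q)
    (ht₁ : t₁ < q) (hne : t₁ ≠ t₀) (h0 : f t₀ = 0) (h1 : f t₁ = 0) :
    ∑ t ∈ Finset.range q, f t ≤ q - 2 := by
  have hm : t₁ ∈ (Finset.range q).erase t₀ := Finset.mem_erase.2 ⟨hne, Finset.mem_range.2 ht₁⟩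
  rw [← Finset.add_sum_erase _ _ (Finset.mem_range.2 ht), h0, zero_add,
    ← Finset.add_sum_erase _ _ hm, h1, zero_add]
  refine (Finset.sum_le_card_nsmul _ _ 1 fun t _ => hf t).trans ?_
  rw [Finset.card_erase_of_mem hm, Finset.card_erase_of_mem (Finset.mem_range.2 ht),
    Finset.card_range, nsmul_eq_mul, mul_one]
  have : q - 1 - 1 = q - 2 := by omega
  rw [this, Nat.cast_sub (by omega)]
  norm_num

/-- The factor at the prime `q ∣ g` in the upper bound for `pairsWithDet g u v e`. -/
def localDensity (u v : ℕ) (e : ℤ) (q : ℕ) : ℝ :=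
  if q ∣ u * v ∨ (q : ℤ) ∣ e then 1 - (q : ℝ)⁻¹ else (1 - (q : ℝ)⁻¹) ^ 2

lemma sum_indicator_le_localDensity {q u v : ℕ} (hq : q.Prime) (huv : Nat.Coprime u v)
    (a b : ℤ) :
    ∑ t ∈ Finset.range q,
      (if (q : ℤ) ∣ a + u * t ∨ (q : ℤ) ∣ b + v * t then (0 : ℝ) else 1) ≤
      q * localDensity u v (a * v - b * u) q := by
  set f : ℕ → ℝ := fun t => if (q : ℤ) ∣ a + u * t ∨ (q : ℤ) ∣ b + v * t then (0 : ℝ) else 1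
    with hf
  have hf1 : ∀ t, f t ≤ 1 := fun t => by
    simp only [hf]
    split_ifs <;> norm_num
  have hq0 : (q : ℝ) ≠ 0 := by exact_mod_cast hq.ne_zero
  have hqp : (0 : ℝ) < q := by exact_mod_cast hq.pos
  have hone : ∑ t ∈ Finset.range q, f t ≤ q * (1 - (q : ℝ)⁻¹) := by
    have e1 : (q : ℝ) * (1 - (q : ℝ)⁻¹) = q - 1 := by field_simp
    rw [e1]
    by_cases hu : q ∣ u
    · have hv : ¬ q ∣ v := fun hv => hq.one_lt.ne' (Nat.dvd_one.1 (huv ▸ Nat.dvd_gcd hu hv))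
      obtain ⟨t, ht, htd⟩ := exists_lt_prime_dvd_add_mul hq b hv
      exact sum_range_le_sub_one hf1 ht (by simp [hf, htd])
    · obtain ⟨t, ht, htd⟩ := exists_lt_prime_dvd_add_mul hq a hu
      exact sum_range_le_sub_one hf1 ht (by simp [hf, htd])
  unfold localDensity
  split_ifs with h
  · exact hone
  · rw [not_or, hq.dvd_mul, not_or] at h
    obtain ⟨t, ht, htd⟩ := exists_lt_prime_dvd_add_mul hq a h.1.1
    obtain ⟨s, hs, hsd⟩ := exists_lt_prime_dvd_add_mul hq b h.1.2
    have hne : s ≠ t := by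
      rintro rfl
      apply h.2
      have := dvd_sub (htd.mul_right (v : ℤ)) (hsd.mul_right (u : ℤ))
      have e2 : (a + u * s) * (v : ℤ) - (b + v * s) * u = a * v - b * u := by ring
      rwa [e2] at this
    refine (sum_range_le_sub_two hf1 ht hs hne (by simp [hf, htd]) (by simp [hf, hsd])).trans ?_
    have e3 : (q : ℝ) * (1 - (q : ℝ)⁻¹) ^ 2 = q - 2 + (q : ℝ)⁻¹ := by
      field_simp
      ring
    rw [e3]
    have := inv_pos.2 hqp
    linarith

lemma card_pairsWithDet_le {g u v : ℕ} (hg : 0 < g) (hu : 0 < u)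
    (huv : Nat.Coprime u v) (e : ℤ) :
    ((pairsWithDet g u v e).card : ℝ) ≤ 3 * g * ∏ q ∈ g.primeFactors, localDensity u v e q := by
  have hloc : ∀ q ∈ g.primeFactors, 0 ≤ localDensity u v e q := fun q hq => by
    have := one_sub_inv_prime_pos (Nat.prime_of_mem_primeFactors hq)
    unfold localDensity
    split_ifs <;> positivity
  rcases (pairsWithDet g u v e).eq_empty_or_nonempty with h | h
  · rw [h, Finset.card_empty, Nat.cast_zero]
    exact mul_nonneg (by positivity) (Finset.prod_nonneg hloc)
  obtain ⟨⟨a, b⟩, hab, hmin⟩ := Finset.exists_min_image _ (fun x : ℤ × ℤ => x.1) h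
  simp only [pairsWithDet, Finset.mem_filter, Finset.mem_product, mem_reducedNumerators] at hab hmin
  obtain ⟨⟨⟨ha1, ha2⟩, hb1, hb2⟩, habe⟩ := hab
  have huz : (0 : ℤ) < u := by exact_mod_cast hu
  set f : ℕ → ℕ → ℝ := fun q t =>
    if (q : ℤ) ∣ a + u * t ∨ (q : ℤ) ∣ b + v * t then (0 : ℝ) else 1 with hf
  have hfp : ∀ q ∈ g.primeFactors, Function.Periodic (f q) q := by
    intro q _ t
    simp only [hf]
    have e1 : (q : ℤ) ∣ a + u * ((t + q : ℕ) : ℤ) ↔ (q : ℤ) ∣ a + u * t := by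
      have : a + u * ((t + q : ℕ) : ℤ) = a + u * t + q * u := by push_cast; ring
      rw [this, dvd_add_left (dvd_mul_right _ _)]
    have e2 : (q : ℤ) ∣ b + v * ((t + q : ℕ) : ℤ) ↔ (q : ℤ) ∣ b + v * t := by
      have : b + v * ((t + q : ℕ) : ℤ) = b + v * t + q * v := by push_cast; ring
      rw [this, dvd_add_left (dvd_mul_right _ _)]
    simp only [e1, e2]
  have hcount : ((pairsWithDet g u v e).card : ℝ) ≤
      ∑ t ∈ Finset.range (3 * g), ∏ q ∈ g.primeFactors, f q t := by
    have hprod : ∀ t, ∏ q ∈ g.primeFactors, f q t =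
        if ∀ q ∈ g.primeFactors, ¬ ((q : ℤ) ∣ a + u * t ∨ (q : ℤ) ∣ b + v * t)
          then (1 : ℝ) else 0 := by
      intro t
      split_ifs with hh
      · exact Finset.prod_eq_one fun q hq => by simp [hf, hh q hq]
      · push Not at hh
        obtain ⟨q, hq, hqd⟩ := hh
        exact Finset.prod_eq_zero hq (by simp [hf, hqd])
    simp only [hprod]
    rw [Finset.sum_boole, Nat.cast_le]
    refine Finset.card_le_card_of_surjOn (fun t : ℕ => ((a + u * t, b + v * t) : ℤ × ℤ)) ?_
    rintro ⟨a', b'⟩ hx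
    have hx' := hmin (a', b') (by simpa [pairsWithDet, mem_reducedNumerators] using hx)
    simp only [Finset.mem_coe, pairsWithDet, Finset.mem_filter, Finset.mem_product,
      mem_reducedNumerators] at hx
    obtain ⟨⟨⟨ha1', ha2'⟩, hb1', hb2'⟩, habe'⟩ := hx
    have hdet : (a' - a) * (v : ℤ) = (b' - b) * u := by linarith
    have hdvd : (u : ℤ) ∣ a' - a := by
      have : IsCoprime (u : ℤ) (v : ℤ) := Nat.isCoprime_iff_coprime.2 huv
      exact this.dvd_of_dvd_mul_right (hdet ▸ dvd_mul_left _ _)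
    obtain ⟨k, hk⟩ := hdvd
    have hk0 : 0 ≤ k := by
      have : 0 ≤ (u : ℤ) * k := by rw [← hk]; simpa using hx'
      exact nonneg_of_mul_nonneg_right this huz
    obtain ⟨t, rfl⟩ := Int.eq_ofNat_of_zero_le hk0
    have hb' : b' - b = v * t := by
      have : (u : ℤ) * (b' - b) = u * (v * t) := by
        rw [hk] at hdet
        linarith
      exact mul_left_cancel₀ huz.ne' this
    have ea : a' = a + u * t := by linarith
    have eb : b' = b + v * t := by linarith
    refine ⟨t, ?_, by simp [ea, eb]⟩
    simp only [Finset.coe_filter, Finset.mem_range, Set.mem_ofPred_eq]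
    constructor
    · rw [abs_le] at ha1 ha1'
      have : (u : ℤ) * t ≤ u * (2 * g) := by
        push_cast at ha1 ha1'
        linarith [ha1.1, ha1'.2]
      have : (t : ℤ) ≤ 2 * g := le_of_mul_le_mul_left this huz
      omega
    · intro q hq hqd
      have hqp := Nat.prime_of_mem_primeFactors hq
      have hqg : (q : ℤ) ∣ g := by exact_mod_cast Nat.dvd_of_mem_primeFactors hq
      rw [← ea, ← eb] at hqd
      rcases hqd with hqd | hqd
      · have := Int.dvd_coe_gcd hqd (show (q : ℤ) ∣ ((g * u : ℕ) : ℤ) by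
          push_cast; exact hqg.mul_right _)
        rw [ha2'] at this
        exact hqp.one_lt.ne' (Nat.dvd_one.1 (by exact_mod_cast this))
      · have := Int.dvd_coe_gcd hqd (show (q : ℤ) ∣ ((g * v : ℕ) : ℤ) by
          push_cast; exact hqg.mul_right _)
        rw [hb2'] at this
        exact hqp.one_lt.ne' (Nat.dvd_one.1 (by exact_mod_cast this))
  refine hcount.trans ?_
  obtain ⟨w, hw⟩ : (∏ q ∈ g.primeFactors, q) ∣ 3 * g :=
    (Nat.prod_primeFactors_dvd g).mul_left 3
  have hprime : ∀ q ∈ g.primeFactors, q.Prime := fun q hq => Nat.prime_of_mem_primeFactors hq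
  rw [hw, sum_range_mul_of_periodic (periodic_prod_primes hfp), sum_range_prod_primes hprime hfp]
  have hw' : (3 * g : ℝ) = (∏ q ∈ g.primeFactors, (q : ℝ)) * w := by
    have := congrArg (Nat.cast : ℕ → ℝ) hw
    push_cast at this
    exact this
  rw [hw', mul_comm _ (w : ℝ), mul_assoc, ← Finset.prod_mul_distrib]
  refine mul_le_mul_of_nonneg_left (Finset.prod_le_prod ?_ ?_) (by positivity)
  · intro q _
    refine Finset.sum_nonneg fun t _ => ?_
    simp only [hf]
    split_ifs <;> norm_num
  · intro q hq
    have := sum_indicator_le_localDensity (hprime q hq) huv a b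
    rwa [habe] at this

lemma eulerDensity_mul_eulerDensity {g u v : ℕ} (hg : g ≠ 0) (hu : u ≠ 0) (hv : v ≠ 0)
    (huv : Nat.Coprime u v) :
    eulerDensity (g * u) * eulerDensity (g * v) = eulerDensity (u * v) *
      ∏ q ∈ g.primeFactors, ((1 - (q : ℝ)⁻¹) * if q ∣ u * v then 1 else (1 - (q : ℝ)⁻¹)) := by
  have hinter : (g * u).primeFactors ∩ (g * v).primeFactors = g.primeFactors := by
    rw [Nat.primeFactors_mul hg hu, Nat.primeFactors_mul hg hv, ← Finset.union_inter_distrib_left,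
      Finset.disjoint_iff_inter_eq_empty.1 huv.disjoint_primeFactors, Finset.union_empty]
  have hunion : (g * u).primeFactors ∪ (g * v).primeFactors =
      g.primeFactors ∪ (u * v).primeFactors := by
    rw [Nat.primeFactors_mul hg hu, Nat.primeFactors_mul hg hv, Nat.primeFactors_mul hu hv]
    ext q
    simp only [Finset.mem_union]
    tauto
  unfold eulerDensity
  rw [← Finset.prod_union_inter, hinter, hunion, Finset.prod_mul_distrib, Finset.union_comm,
    ← Finset.union_sdiff_self_eq_union, Finset.prod_union Finset.disjoint_sdiff]
  have : ∏ q ∈ g.primeFactors \ (u * v).primeFactors, (1 - (q : ℝ)⁻¹) =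
      ∏ q ∈ g.primeFactors, (if q ∣ u * v then 1 else (1 - (q : ℝ)⁻¹)) := by
    rw [Finset.prod_ite, Finset.prod_const_one, one_mul]
    congr 1
    ext q
    simp only [Finset.mem_sdiff, Finset.mem_filter, Nat.mem_primeFactors]
    have : u * v ≠ 0 := mul_ne_zero hu hv
    tauto
  rw [this]
  ring

lemma prod_localDensity_le {g u v c : ℕ} (hg : g ≠ 0) (hu : u ≠ 0) (hv : v ≠ 0)
    (huv : Nat.Coprime u v) {e : ℤ}
    (hc : ∀ q ∈ g.primeFactors, (q : ℤ) ∣ e → q ∈ c.primeFactors) :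
    ∏ q ∈ g.primeFactors, localDensity u v e q ≤
      eulerDensity (g * u) * eulerDensity (g * v) / eulerDensity (u * v) *
        ∏ q ∈ c.primeFactors, (1 - (q : ℝ)⁻¹)⁻¹ := by
  rw [eulerDensity_mul_eulerDensity hg hu hv huv,
    mul_div_cancel_left₀ _ (eulerDensity_pos _).ne']
  have hinv : ∀ q : ℕ, q.Prime → 1 ≤ (1 - (q : ℝ)⁻¹)⁻¹ := fun q hq => by
    have h1 := one_sub_inv_prime_pos hq
    rw [one_le_inv₀ h1]
    have : (0 : ℝ) ≤ (q : ℝ)⁻¹ := by positivity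
    linarith
  calc _ ≤ ∏ q ∈ g.primeFactors, (((1 - (q : ℝ)⁻¹) * if q ∣ u * v then 1 else (1 - (q : ℝ)⁻¹)) *
          if q ∈ c.primeFactors then (1 - (q : ℝ)⁻¹)⁻¹ else 1) := by
        refine Finset.prod_le_prod ?_ ?_
        · intro q hq
          have := one_sub_inv_prime_pos (Nat.prime_of_mem_primeFactors hq)
          unfold localDensity
          split_ifs <;> positivity
        · intro q hq
          have hqp := Nat.prime_of_mem_primeFactors hq
          have h1 := one_sub_inv_prime_pos hqp
          have h2 := hinv q hqp
          have h3 : (1 - (q : ℝ)⁻¹) * (1 - (q : ℝ)⁻¹)⁻¹ = 1 := mul_inv_cancel₀ h1.ne'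
          unfold localDensity
          by_cases huvq : q ∣ u * v
          · rw [if_pos (Or.inl huvq), if_pos huvq, mul_one]
            split_ifs <;> nlinarith
          · by_cases he : (q : ℤ) ∣ e
            · rw [if_pos (Or.inr he), if_neg huvq, if_pos (hc q hq he), mul_assoc, h3, mul_one]
            · rw [if_neg (by tauto), if_neg huvq, ← sq]
              split_ifs
              · nlinarith [sq_nonneg (1 - (q : ℝ)⁻¹)]
              · rw [mul_one]
    _ ≤ _ := by
        rw [Finset.prod_mul_distrib]
        refine mul_le_mul_of_nonneg_left ?_ ?_
        · rw [← Finset.prod_filter]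
          refine Finset.prod_le_prod_of_subset_of_one_le ?_ ?_ ?_
          · intro q hq
            exact (Finset.mem_filter.1 hq).2
          · intro q hq
            exact (zero_le_one.trans (hinv q (Nat.prime_of_mem_primeFactors
              (Finset.mem_filter.1 hq).1)))
          · intro q hq _
            exact hinv q (Nat.prime_of_mem_primeFactors hq)
        · refine Finset.prod_nonneg fun q hq => ?_
          have := one_sub_inv_prime_pos (Nat.prime_of_mem_primeFactors hq)
          split_ifs <;> positivity

end PairCount

section PairCount

lemma eq_one_of_dvd_of_gcd_eq_one {q n : ℕ} {a : ℤ} (hqa : (q : ℤ) ∣ a) (hqn : q ∣ n)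
    (h : Int.gcd a n = 1) : q = 1 := by
  have := Int.dvd_coe_gcd hqa (Int.natCast_dvd_natCast.2 hqn)
  rw [h] at this
  exact Nat.dvd_one.1 (by exact_mod_cast this)

lemma coprime_of_mem_pairsWithDet {g u v c : ℕ} {e : ℤ} (huv : Nat.Coprime u v)
    (hce : (c : ℤ) ∣ e) {x : ℤ × ℤ} (hx : x ∈ pairsWithDet g u v e) :
    Nat.Coprime c (u * v) := by
  simp only [pairsWithDet, Finset.mem_filter, Finset.mem_product, mem_reducedNumerators] at hx
  obtain ⟨⟨⟨-, ha⟩, -, hb⟩, he⟩ := hx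
  rw [Nat.coprime_mul_iff_right]
  constructor
  · refine Nat.coprime_of_dvd fun q hq hqc hqu => hq.one_lt.ne' ?_
    have h1 : (q : ℤ) ∣ x.1 * v := by
      have h2 : (q : ℤ) ∣ e := (Int.natCast_dvd_natCast.2 hqc).trans hce
      have h3 : (q : ℤ) ∣ x.2 * u := (Int.natCast_dvd_natCast.2 hqu).mul_left _
      have : x.1 * v = e + x.2 * u := by linarith
      rw [this]
      exact dvd_add h2 h3
    rcases (Nat.prime_iff_prime_int.1 hq).dvd_or_dvd h1 with h | h
    · exact eq_one_of_dvd_of_gcd_eq_one h (hqu.mul_left g) ha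
    · exact Nat.dvd_one.1 (huv ▸ Nat.dvd_gcd hqu (Int.natCast_dvd_natCast.1 h))
  · refine Nat.coprime_of_dvd fun q hq hqc hqv => hq.one_lt.ne' ?_
    have h1 : (q : ℤ) ∣ x.2 * u := by
      have h2 : (q : ℤ) ∣ e := (Int.natCast_dvd_natCast.2 hqc).trans hce
      have h3 : (q : ℤ) ∣ x.1 * v := (Int.natCast_dvd_natCast.2 hqv).mul_left _
      have : x.2 * u = x.1 * v - e := by linarith
      rw [this]
      exact dvd_sub h3 h2
    rcases (Nat.prime_iff_prime_int.1 hq).dvd_or_dvd h1 with h | h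
    · exact eq_one_of_dvd_of_gcd_eq_one h (hqv.mul_left g) hb
    · exact Nat.dvd_one.1 (huv ▸ Nat.dvd_gcd (Int.natCast_dvd_natCast.1 h) hqv)

lemma card_pairsWithDet_zero_le {g u v : ℕ} (huv : Nat.Coprime u v) :
    (pairsWithDet g u v 0).card ≤ if u = v then (reducedNumerators (g * u)).card else 0 := by
  rcases (pairsWithDet g u v 0).eq_empty_or_nonempty with h | ⟨x, hx⟩
  · simp [h]
  · have hc := coprime_of_mem_pairsWithDet (c := u * v) huv (dvd_zero _) hx
    rw [Nat.coprime_self] at hc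
    obtain ⟨rfl, rfl⟩ := Nat.eq_one_of_mul_eq_one_right hc, Nat.eq_one_of_mul_eq_one_left hc
    rw [if_pos rfl]
    refine Finset.card_le_card_of_injOn Prod.fst ?_ ?_
    · intro x hx
      simp only [pairsWithDet, Finset.coe_filter, Finset.mem_product, Set.mem_ofPred_eq] at hx
      exact hx.1.1
    · intro x hx y hy hxy
      simp only [pairsWithDet, Finset.coe_filter, Finset.mem_product, Set.mem_ofPred_eq,
        Nat.cast_one, mul_one] at hx hy
      ext
      · exact hxy
      · linarith [hx.2, hy.2]

lemma card_pairsWithDet_le_of_dvd {p l g u v c : ℕ} (hp : p.Prime) (hpg : ¬ p ∣ g) (hg : 0 < g)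
    (hu : 0 < u) (hv : 0 < v) (hc : 0 < c) (huv : Nat.Coprime u v) {e : ℤ}
    (he : e = (p : ℤ) ^ l * c ∨ e = -((p : ℤ) ^ l * c)) :
    ((pairsWithDet g u v e).card : ℝ) ≤
      3 * g * (eulerDensity (g * u) * eulerDensity (g * v) / eulerDensity (u * v)) *
        ∏ q ∈ c.primeFactors, (1 - (q : ℝ)⁻¹)⁻¹ := by
  refine (card_pairsWithDet_le hg hu huv e).trans ?_
  rw [mul_assoc (3 * (g : ℝ))]
  refine mul_le_mul_of_nonneg_left (prod_localDensity_le hg.ne' hu.ne' hv.ne' huv ?_)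
    (by positivity)
  intro q hq hqe
  have hqp := Nat.prime_of_mem_primeFactors hq
  have h1 : (q : ℤ) ∣ (p : ℤ) ^ l * c := by
    rcases he with he | he
    · rwa [he] at hqe
    · rwa [he, dvd_neg] at hqe
  have h2 : q ∣ p ^ l * c := by exact_mod_cast h1
  rw [hqp.dvd_mul] at h2
  rcases h2 with h2 | h2
  · have := (Nat.prime_dvd_prime_iff_eq hqp hp).1 (hqp.dvd_of_dvd_pow h2)
    exact absurd (this ▸ Nat.dvd_of_mem_primeFactors hq) hpg
  · exact Nat.mem_primeFactors.2 ⟨hqp, h2, hc.ne'⟩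

lemma closePairs_subset {p l g u v : ℕ} (hp : p.Prime) (hpg : ¬ p ∣ g)
    (huv : Nat.Coprime u v) :
    closePairs p l (g * u) (g * v) ⊆ pairsWithDet g u v 0 ∪
      ({c ∈ Finset.Icc 1 (16 * (g * u * v) / p ^ l) | Nat.Coprime c (u * v)}).biUnion
        fun c => pairsWithDet g u v ((p : ℤ) ^ l * c) ∪
          pairsWithDet g u v (-((p : ℤ) ^ l * c)) := by
  rintro ⟨a, b⟩ hx
  simp only [closePairs, Finset.mem_filter, Finset.mem_product] at hx
  obtain ⟨hab, hd⟩ := hx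
  have hmem : ∀ e, a * v - b * u = e → (a, b) ∈ pairsWithDet g u v e := fun e he => by
    simp only [pairsWithDet, Finset.mem_filter, Finset.mem_product]
    exact ⟨hab, he⟩
  have hpl : (0 : ℤ) < (p : ℤ) ^ l := by
    have := hp.pos
    positivity
  have hd' : (p : ℤ) ^ l ∣ a * v - b * u := by
    have h1 : IsCoprime ((p : ℤ) ^ l) (g : ℤ) :=
      (Nat.isCoprime_iff_coprime.2 ((Nat.Prime.coprime_iff_not_dvd hp).2 hpg)).pow_left
    have h2 : (g : ℤ) * (a * v - b * u) = a * ((g * v : ℕ) : ℤ) - b * ((g * u : ℕ) : ℤ) := by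
      push_cast
      ring
    have h3 : (p : ℤ) ^ l ∣ (g : ℤ) * (a * v - b * u) := by
      rw [h2]
      exact hd
    exact h1.dvd_of_dvd_mul_left h3
  obtain ⟨k, hk⟩ := hd'
  rw [Finset.mem_union]
  by_cases hk0 : k = 0
  · left
    exact hmem 0 (by rw [hk, hk0, mul_zero])
  right
  have hke : a * v - b * u = (p : ℤ) ^ l * (k.natAbs : ℕ) ∨
      a * v - b * u = -((p : ℤ) ^ l * (k.natAbs : ℕ)) := by
    rcases Int.natAbs_eq k with h | h
    · left
      rw [hk, ← h]
    · right
      rw [hk, ← mul_neg, ← h]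
  have hmem' : (a, b) ∈ pairsWithDet g u v ((p : ℤ) ^ l * (k.natAbs : ℕ)) ∪
      pairsWithDet g u v (-((p : ℤ) ^ l * (k.natAbs : ℕ))) := by
    rw [Finset.mem_union]
    exact hke.imp (hmem _) (hmem _)
  rw [Finset.mem_biUnion]
  refine ⟨k.natAbs, ?_, hmem'⟩
  rw [Finset.mem_filter, Finset.mem_Icc]
  refine ⟨⟨Int.natAbs_pos.2 hk0, ?_⟩, ?_⟩
  · rw [Nat.le_div_iff_mul_le (pow_pos hp.pos l)]
    have h1 : |a * v - b * u| ≤ 2 * (g * u * v) := by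
      have ha := (mem_reducedNumerators.1 hab.1).1
      have hb := (mem_reducedNumerators.1 hab.2).1
      push_cast at ha hb
      calc |a * v - b * u| ≤ |a * v| + |b * u| := abs_sub _ _
        _ = |a| * v + |b| * u := by rw [abs_mul, abs_mul, Nat.abs_cast, Nat.abs_cast]
        _ ≤ (g * u) * v + (g * v) * u := by gcongr
        _ = _ := by ring
    have h2 : |a * v - b * u| = ((k.natAbs * p ^ l : ℕ) : ℤ) := by
      rw [hk, abs_mul, abs_of_pos hpl]
      push_cast
      ring
    rw [h2] at h1
    have h3 : k.natAbs * p ^ l ≤ 2 * (g * u * v) := by exact_mod_cast h1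
    omega
  · rw [Finset.mem_union] at hmem'
    rcases hmem' with h | h
    · exact coprime_of_mem_pairsWithDet huv (dvd_mul_left _ _) h
    · exact coprime_of_mem_pairsWithDet huv ((dvd_mul_left _ _).neg_right) h

/-- In the range of large radii the pair count has the expected order of magnitude. -/
lemma card_closePairs_le {p l m n : ℕ} (hp : p.Prime) (hpm : ¬ p ∣ m)
    (hm : 0 < m) (hn : 0 < n) (hlm : p ^ l ≤ 8 * m) (hln : p ^ l ≤ 8 * n) :
    ((closePairs p l m n).card : ℝ) ≤ (if m = n then ((reducedNumerators m).card : ℝ) else 0) +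
      192 * Real.exp 13 * (m.totient * n.totient / (p : ℝ) ^ l) := by
  obtain ⟨g, u, v, hg, huv, rfl, rfl⟩ : ∃ g u v : ℕ, 0 < g ∧ Nat.Coprime u v ∧
      m = g * u ∧ n = g * v := by
    obtain ⟨g, u, v, hg, h⟩ := Nat.exists_coprime' (m := m) (n := n) (Nat.gcd_pos_of_pos_left n hm)
    exact ⟨g, u, v, hg, h.1, by rw [h.2.1, mul_comm], by rw [h.2.2, mul_comm]⟩
  have hu : 0 < u := Nat.pos_of_mul_pos_left hm
  have hv : 0 < v := Nat.pos_of_mul_pos_left hn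
  have hpg : ¬ p ∣ g := fun h => hpm (h.mul_right u)
  have hpl : 0 < p ^ l := pow_pos hp.pos l
  have hplR : (0 : ℝ) < (p : ℝ) ^ l := by exact_mod_cast hpl
  set X := 16 * (g * u * v) / p ^ l with hX
  have hXv : v ≤ X := by
    rw [hX, Nat.le_div_iff_mul_le hpl]
    calc v * p ^ l ≤ v * (8 * (g * u)) := Nat.mul_le_mul_left v hlm
      _ ≤ 16 * (g * u * v) := by nlinarith [Nat.zero_le (g * u * v)]
  have hXu : u ≤ X := by
    rw [hX, Nat.le_div_iff_mul_le hpl]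
    calc u * p ^ l ≤ u * (8 * (g * v)) := Nat.mul_le_mul_left u hln
      _ ≤ 16 * (g * u * v) := by nlinarith [Nat.zero_le (g * u * v)]
  have hXR : (X : ℝ) ≤ 16 * (g * u * v) / (p : ℝ) ^ l := by
    have := Nat.cast_div_le (α := ℝ) (m := 16 * (g * u * v)) (n := p ^ l)
    rw [← hX] at this
    push_cast at this
    exact this
  have hsieve := sum_coprime_inv_density_le (mul_ne_zero hu.ne' hv.ne') (X := X) (by omega)
    (by rw [sq]; exact Nat.mul_le_mul hXu hXv)
  set E := eulerDensity (g * u) * eulerDensity (g * v) / eulerDensity (u * v) with hE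
  have hE0 : 0 < E := div_pos (mul_pos (eulerDensity_pos _) (eulerDensity_pos _))
    (eulerDensity_pos _)
  have hcard : (closePairs p l (g * u) (g * v)).card ≤ (pairsWithDet g u v 0).card +
      ∑ c ∈ Finset.Icc 1 X with Nat.Coprime c (u * v),
        ((pairsWithDet g u v ((p : ℤ) ^ l * c)).card +
          (pairsWithDet g u v (-((p : ℤ) ^ l * c))).card) := by
    refine (Finset.card_le_card (closePairs_subset hp hpg huv)).trans ?_
    refine (Finset.card_union_le _ _).trans (Nat.add_le_add_left ?_ _)
    refine Finset.card_biUnion_le.trans (Finset.sum_le_sum fun c _ => Finset.card_union_le _ _)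
  have hzero : ((pairsWithDet g u v 0).card : ℝ) ≤
      if g * u = g * v then ((reducedNumerators (g * u)).card : ℝ) else 0 := by
    have h := card_pairsWithDet_zero_le (g := g) huv
    by_cases huv' : u = v
    · rw [if_pos huv'] at h
      rw [if_pos (by rw [huv'])]
      exact_mod_cast h
    · rw [if_neg huv'] at h
      rw [if_neg (fun h' => huv' (Nat.eq_of_mul_eq_mul_left hg h'))]
      exact_mod_cast h
  have hterm : ∀ c ∈ (Finset.Icc 1 X).filter (Nat.Coprime · (u * v)),
      (((pairsWithDet g u v ((p : ℤ) ^ l * c)).card : ℝ) +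
          (pairsWithDet g u v (-((p : ℤ) ^ l * c))).card) ≤
        6 * g * E * ∏ q ∈ c.primeFactors, (1 - (q : ℝ)⁻¹)⁻¹ := by
    intro c hc
    have hc0 : 0 < c := (Finset.mem_Icc.1 (Finset.mem_filter.1 hc).1).1
    have h1 := card_pairsWithDet_le_of_dvd hp hpg hg hu hv hc0 huv (l := l) (Or.inl rfl)
    have h2 := card_pairsWithDet_le_of_dvd hp hpg hg hu hv hc0 huv (l := l) (Or.inr rfl)
    linarith
  calc ((closePairs p l (g * u) (g * v)).card : ℝ)
      ≤ (pairsWithDet g u v 0).card + ∑ c ∈ Finset.Icc 1 X with Nat.Coprime c (u * v),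
        (((pairsWithDet g u v ((p : ℤ) ^ l * c)).card : ℝ) +
          (pairsWithDet g u v (-((p : ℤ) ^ l * c))).card) := by exact_mod_cast hcard
    _ ≤ (if g * u = g * v then ((reducedNumerators (g * u)).card : ℝ) else 0) +
        6 * g * E * (2 * Real.exp 13 * X * eulerDensity (u * v)) := by
        refine add_le_add hzero ((Finset.sum_le_sum hterm).trans ?_)
        rw [← Finset.mul_sum]
        exact mul_le_mul_of_nonneg_left hsieve (by positivity)
    _ ≤ _ := by
        refine add_le_add_right ?_ _
        rw [totient_eq_mul_eulerDensity, totient_eq_mul_eulerDensity]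
        have hEe : E * eulerDensity (u * v) = eulerDensity (g * u) * eulerDensity (g * v) :=
          div_mul_cancel₀ _ (eulerDensity_pos _).ne'
        have h0 : 0 ≤ eulerDensity (g * u) * eulerDensity (g * v) :=
          (mul_pos (eulerDensity_pos _) (eulerDensity_pos _)).le
        calc 6 * g * E * (2 * Real.exp 13 * X * eulerDensity (u * v))
            = 12 * Real.exp 13 * g * (E * eulerDensity (u * v)) * X := by ring
          _ ≤ 12 * Real.exp 13 * g * (E * eulerDensity (u * v)) *
                (16 * (g * u * v) / (p : ℝ) ^ l) := by
              refine mul_le_mul_of_nonneg_left hXR ?_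
              rw [hEe]
              positivity
          _ = _ := by
              rw [hEe]
              push_cast
              ring

end PairCount

section TotientBound

lemma le_mul_totient_prime_pow_sq {q k : ℕ} (hq : q.Prime) (hk : 0 < k) :
    q ^ k ≤ (if 2 ∣ q ^ k then 2 else 1) * (q ^ k).totient ^ 2 := by
  obtain ⟨j, rfl⟩ := Nat.exists_eq_succ_of_ne_zero hk.ne'
  rw [Nat.totient_prime_pow_succ hq]
  have h1 : q ≤ (if 2 ∣ q ^ j.succ then 2 else 1) * (q - 1) ^ 2 := by
    rcases hq.eq_two_or_odd' with rfl | hodd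
    · rw [if_pos (dvd_pow_self 2 (Nat.succ_ne_zero j))]
      norm_num
    · have h2 : ¬ 2 ∣ q ^ j.succ := fun h => by
        have := Nat.prime_two.dvd_of_dvd_pow h
        exact (Nat.not_even_iff_odd.2 hodd) (even_iff_two_dvd.2 this)
      rw [if_neg h2, one_mul]
      have h3 : 3 ≤ q := by
        have := hq.two_le
        rcases hodd with ⟨t, ht⟩
        omega
      obtain ⟨t, rfl⟩ := Nat.exists_eq_add_of_le h3
      have : 3 + t - 1 = t + 2 := by omega
      rw [this]
      nlinarith
  calc q ^ j.succ = q ^ j * q := pow_succ q j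
    _ ≤ (q ^ j * q ^ j) * ((if 2 ∣ q ^ j.succ then 2 else 1) * (q - 1) ^ 2) := by
        gcongr
        exact Nat.le_mul_of_pos_left _ (pow_pos hq.pos j)
    _ = _ := by ring

lemma le_two_mul_totient_sq (n : ℕ) : n ≤ 2 * n.totient ^ 2 := by
  have key : n ≤ (if 2 ∣ n then 2 else 1) * n.totient ^ 2 := by
    induction n using Nat.recOnPosPrimePosCoprime with
    | prime_pow q k hq hk => exact le_mul_totient_prime_pow_sq hq hk
    | zero => simp
    | one => simp
    | coprime a b ha hb hab iha ihb =>
      rw [Nat.totient_mul hab]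
      refine (Nat.mul_le_mul iha ihb).trans ?_
      have h2 : (if 2 ∣ a then 2 else 1) * (if 2 ∣ b then 2 else 1) ≤
          if 2 ∣ a * b then 2 else 1 := by
        by_cases h : 2 ∣ a
        · have h' : ¬ 2 ∣ b := fun h' => by
            have := Nat.dvd_gcd h h'
            rw [hab] at this
            omega
          rw [if_pos h, if_neg h', if_pos (h.mul_right b)]
        · by_cases h' : 2 ∣ b
          · rw [if_neg h, if_pos h', if_pos (h'.mul_left a)]
          · rw [if_neg h, if_neg h', one_mul]
            split_ifs <;> omega
      calc _ = ((if 2 ∣ a then 2 else 1) * (if 2 ∣ b then 2 else 1)) *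
          (a.totient * b.totient) ^ 2 := by ring
        _ ≤ _ := Nat.mul_le_mul_right _ h2
  refine key.trans (Nat.mul_le_mul_right _ ?_)
  split_ifs <;> omega

end TotientBound

section KochenStone

open scoped ENNReal

variable {α : Type*} [MeasurableSpace α]

lemma lintegral_sq_le_measure_mul (μ : Measure α) {h : α → ℝ≥0∞} (hh : Measurable h)
    {U : Set α} (hU : MeasurableSet U) (hsupp : ∀ x ∉ U, h x = 0) :
    (∫⁻ x, h x ∂μ) ^ 2 ≤ (∫⁻ x, h x ^ 2 ∂μ) * μ U := by
  have h1 : ∀ x, h x = (h * U.indicator (1 : α → ℝ≥0∞)) x := fun x => by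
    by_cases hx : x ∈ U
    · simp [hx]
    · simp [hx, hsupp x hx]
  have h2 := ENNReal.lintegral_mul_le_Lp_mul_Lq μ Real.HolderConjugate.two_two
    hh.aemeasurable ((measurable_one.indicator hU).aemeasurable (μ := μ))
  rw [← lintegral_congr h1] at h2
  have h3 : ∀ x, (U.indicator (1 : α → ℝ≥0∞) x) ^ (2 : ℝ) = U.indicator 1 x := fun x => by
    by_cases hx : x ∈ U <;> simp [hx]
  rw [lintegral_congr h3, lintegral_indicator_one hU] at h2
  have h4 : ∀ z : ℝ≥0∞, (z ^ (1 / 2 : ℝ)) ^ 2 = z := fun z => by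
    rw [← ENNReal.rpow_natCast, ← ENNReal.rpow_mul]
    norm_num
  calc (∫⁻ x, h x ∂μ) ^ 2 ≤ _ := pow_le_pow_left' h2 2
    _ = _ := by
      rw [mul_pow, h4, h4]
      simp [ENNReal.rpow_ofNat]

theorem measure_frequently_ne_zero_pos (μ : Measure α) [IsFiniteMeasure μ]
    {f : ℕ → α → ℝ≥0∞} (hf : ∀ n, Measurable (f n)) (hfin : ∀ n, ∫⁻ x, f n x ∂μ ≠ ∞)
    (hdiv : ∑' n, ∫⁻ x, f n x ∂μ = ∞) {C : ℝ≥0∞} (hC : C ≠ ∞)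
    (hfreq : ∃ᶠ N in atTop, ∑ m ∈ Finset.range N, ∑ n ∈ Finset.range N,
      ∫⁻ x, f m x * f n x ∂μ ≤ C * (∑ n ∈ Finset.range N, ∫⁻ x, f n x ∂μ) ^ 2) :
    0 < μ {x | ∃ᶠ n in atTop, f n x ≠ 0} := by
  set U : ℕ → Set α := fun M => ⋃ n ≥ M, {x | f n x ≠ 0} with hUdef
  have hUm : ∀ M, MeasurableSet (U M) := fun M =>
    MeasurableSet.biUnion (Set.to_countable _) fun n _ =>
      (hf n (measurableSet_singleton 0)).compl
  have hset : {x | ∃ᶠ n in atTop, f n x ≠ 0} = ⋂ M, U M := by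
    ext x
    simp [hUdef, frequently_atTop]
  have htend : Tendsto (fun N => ∑ n ∈ Finset.range N, ∫⁻ x, f n x ∂μ) atTop (nhds ∞) := by
    have := ENNReal.summable.hasSum.tendsto_sum_nat (f := fun n => ∫⁻ x, f n x ∂μ)
    rwa [hdiv] at this
  have hlow : ∀ M, 1 ≤ 4 * C * μ (U M) := fun M => by
    have hSMfin : ∑ n ∈ Finset.range M, ∫⁻ x, f n x ∂μ ≠ ∞ :=
      ENNReal.sum_ne_top.2 fun n _ => hfin n
    have hev := htend.eventually (lt_mem_nhds (a := 2 * ∑ n ∈ Finset.range M,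
      ∫⁻ x, f n x ∂μ + 1) (by finiteness))
    obtain ⟨N, hN, hlt, hMN⟩ := (hfreq.and_eventually (hev.and (eventually_ge_atTop M))).exists
    set S := ∑ n ∈ Finset.range N, ∫⁻ x, f n x ∂μ with hS
    set T := ∑ n ∈ Finset.range M, ∫⁻ x, f n x ∂μ with hT
    have hSfin : S ≠ ∞ := ENNReal.sum_ne_top.2 fun n _ => hfin n
    set h : α → ℝ≥0∞ := fun x => ∑ n ∈ Finset.Ico M N, f n x with hh
    have hhm : Measurable h := Finset.measurable_sum _ fun n _ => hf n
    have h_int : ∫⁻ x, h x ∂μ = ∑ n ∈ Finset.Ico M N, ∫⁻ x, f n x ∂μ :=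
      lintegral_finsetSum _ fun n _ => hf n
    have hST : S = T + ∫⁻ x, h x ∂μ := by
      rw [h_int, hS, hT, Finset.sum_range_add_sum_Ico _ hMN]
    have hhalf : S ≤ 2 * ∫⁻ x, h x ∂μ := by
      have h5 : T + T ≤ T + ∫⁻ x, h x ∂μ := by
        rw [← hST, ← two_mul]
        exact le_self_add.trans hlt.le
      have h6 : T ≤ ∫⁻ x, h x ∂μ := (ENNReal.add_le_add_iff_left hSMfin).1 h5
      rw [hST, two_mul]
      gcongr
    have hsq : ∫⁻ x, h x ^ 2 ∂μ ≤ C * S ^ 2 := by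
      refine le_trans ?_ hN
      have h7 : ∀ x, h x ^ 2 ≤ ∑ m ∈ Finset.range N, ∑ n ∈ Finset.range N, f m x * f n x :=
        fun x => by
          rw [← Finset.sum_mul_sum, ← sq]
          refine pow_le_pow_left' (Finset.sum_le_sum_of_subset ?_) 2
          intro n hn
          exact Finset.mem_range.2 (Finset.mem_Ico.1 hn).2
      refine (lintegral_mono h7).trans_eq ?_
      have h8 : ∀ m n, Measurable fun x => f m x * f n x := fun m n => (hf m).mul (hf n)
      rw [lintegral_finsetSum _ fun m _ => Finset.measurable_sum _ fun n _ => h8 m n]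
      exact Finset.sum_congr rfl fun m _ => lintegral_finsetSum _ fun n _ => h8 m n
    have hcs := lintegral_sq_le_measure_mul μ hhm (hUm M) fun x hx => by
      refine Finset.sum_eq_zero fun n hn => ?_
      by_contra hne
      exact hx (Set.mem_biUnion (Finset.mem_Ico.1 hn).1 hne)
    have hS0 : S ≠ 0 := fun h0 => by
      rw [h0] at hlt
      exact not_lt_zero hlt
    have hfinal : S ^ 2 * 1 ≤ S ^ 2 * (4 * C * μ (U M)) := by
      calc S ^ 2 * 1 ≤ (2 * ∫⁻ x, h x ∂μ) ^ 2 := by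
            rw [mul_one]
            exact pow_le_pow_left' hhalf 2
        _ = 4 * (∫⁻ x, h x ∂μ) ^ 2 := by ring
        _ ≤ 4 * (C * S ^ 2 * μ (U M)) := by
            gcongr
            exact hcs.trans (by gcongr)
        _ = _ := by ring
    exact (ENNReal.mul_le_mul_iff_right (pow_ne_zero 2 hS0) (by finiteness)).1 hfinal
  have hanti : Antitone U := fun M N hMN => by
    refine Set.biUnion_subset_biUnion_left ?_
    intro n hn
    exact le_trans hMN hn
  have hlim := tendsto_measure_iInter_atTop (μ := μ) (fun M => (hUm M).nullMeasurableSet)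
    hanti ⟨0, measure_ne_top μ _⟩
  rw [hset, pos_iff_ne_zero]
  intro h0
  rw [h0] at hlim
  have hlim2 : Tendsto (fun M => 4 * C * μ (U M)) atTop (nhds (4 * C * 0)) :=
    ENNReal.Tendsto.const_mul hlim (Or.inr (by finiteness))
  have := ge_of_tendsto' hlim2 hlow
  simp at this

end KochenStone

section PadicMeasure

open scoped ENNReal Topology
open Metric

variable {p : ℕ} [Fact p.Prime]

lemma inv_natCast_pow_eq_zpow (p j : ℕ) : ((p : ℝ)⁻¹) ^ j = (p : ℝ) ^ (-(j : ℤ)) := by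
  rw [inv_pow, zpow_neg, zpow_natCast]

lemma exists_lt_mem_closedBall (x : ℤ_[p]) (j : ℕ) :
    ∃ c : ℕ, c < p ^ j ∧ x ∈ closedBall (c : ℤ_[p]) ((p : ℝ)⁻¹ ^ j) := by
  refine ⟨x.appr j, PadicInt.appr_lt x j, ?_⟩
  rw [mem_closedBall, dist_eq_norm, inv_natCast_pow_eq_zpow,
    PadicInt.norm_le_pow_iff_mem_span_pow]
  exact PadicInt.appr_spec j x

lemma norm_intCast_le_inv_pow_iff {k : ℤ} {j : ℕ} :
    ‖(k : ℤ_[p])‖ ≤ (p : ℝ)⁻¹ ^ j ↔ (p : ℤ) ^ j ∣ k := by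
  rw [inv_natCast_pow_eq_zpow, PadicInt.norm_int_le_pow_iff_dvd]

lemma closedBall_eq_of_mem {x y : ℤ_[p]} {r : ℝ} (h : x ∈ closedBall y r) :
    closedBall x r = closedBall y r :=
  (IsUltrametricDist.closedBall_eq_of_mem h).symm

lemma natCast_p_ne_zero : (p : ℤ_[p]) ≠ 0 := by
  exact_mod_cast (Fact.out : p.Prime).ne_zero

lemma range_add_pow_mul (c : ℤ_[p]) (j : ℕ) :
    Set.range (fun z : ℤ_[p] => c + (p : ℤ_[p]) ^ j * z) = closedBall c ((p : ℝ)⁻¹ ^ j) := by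
  ext x
  rw [mem_closedBall, dist_eq_norm, inv_natCast_pow_eq_zpow,
    PadicInt.norm_le_pow_iff_mem_span_pow, Ideal.mem_span_singleton]
  constructor
  · rintro ⟨z, rfl⟩
    exact ⟨z, by ring⟩
  · rintro ⟨z, hz⟩
    exact ⟨z, by simp only [← hz]; ring⟩

variable [MeasurableSpace ℤ_[p]] [BorelSpace ℤ_[p]]

lemma measure_closedBall_inv_pow (μ : Measure ℤ_[p]) [μ.IsAddLeftInvariant]
    [IsProbabilityMeasure μ] (x : ℤ_[p]) (j : ℕ) :
    μ (closedBall x ((p : ℝ)⁻¹ ^ j)) = (p : ℝ≥0∞)⁻¹ ^ j := by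
  set r : ℝ := (p : ℝ)⁻¹ ^ j
  have htrans : ∀ y : ℤ_[p], μ (closedBall y r) = μ (closedBall 0 r) := fun y => by
    have := measure_preimage_add μ y (closedBall y r)
    rw [← this, preimage_add_closedBall, sub_self]
  have hcover : (⋃ c ∈ Finset.range (p ^ j), closedBall (c : ℤ_[p]) r) = Set.univ := by
    refine Set.eq_univ_of_forall fun y => ?_
    obtain ⟨c, hc, hy⟩ := exists_lt_mem_closedBall y j
    exact Set.mem_biUnion (Finset.mem_coe.2 (Finset.mem_range.2 hc)) hy
  have hdisj : (Finset.range (p ^ j) : Set ℕ).PairwiseDisjoint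
      fun c : ℕ => closedBall (c : ℤ_[p]) r := by
    intro c hc d hd hcd
    refine Set.disjoint_left.2 fun y hyc hyd => hcd ?_
    have h1 : (c : ℤ_[p]) ∈ closedBall (d : ℤ_[p]) r := by
      rw [← closedBall_eq_of_mem hyd, closedBall_eq_of_mem hyc]
      exact mem_closedBall_self (by positivity)
    rw [mem_closedBall, dist_eq_norm] at h1
    have h2 : (p : ℤ) ^ j ∣ (c : ℤ) - d := by
      rw [← norm_intCast_le_inv_pow_iff]
      push_cast
      exact h1
    have hc' : (c : ℤ) < (p : ℤ) ^ j := by exact_mod_cast Finset.mem_range.1 hc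
    have hd' : (d : ℤ) < (p : ℤ) ^ j := by exact_mod_cast Finset.mem_range.1 hd
    have := Int.eq_zero_of_abs_lt_dvd h2 (abs_lt.2 ⟨by omega, by omega⟩)
    omega
  have hsum := measure_biUnion_finset (μ := μ) hdisj fun c _ => isClosed_closedBall.measurableSet
  rw [hcover, measure_univ] at hsum
  simp only [htrans, Finset.sum_const, Finset.card_range, nsmul_eq_mul] at hsum
  rw [htrans, ← ENNReal.inv_pow]
  refine ENNReal.eq_inv_of_mul_eq_one_left ?_
  rw [mul_comm, hsum]
  push_cast
  rfl

lemma isUnifLocDoublingMeasure_padicInt (μ : Measure ℤ_[p]) [μ.IsAddLeftInvariant]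
    [IsProbabilityMeasure μ] : IsUnifLocDoublingMeasure μ := by
  have hp1 : 1 < p := (Fact.out : p.Prime).one_lt
  have hp0 : (0 : ℝ) < p := by positivity
  have hinv : (p : ℝ)⁻¹ < 1 := inv_lt_one_of_one_lt₀ (by exact_mod_cast hp1)
  have hmeas : ∀ (x : ℤ_[p]) (j : ℕ),
      μ (closedBall x ((p : ℝ)⁻¹ ^ j)) = ENNReal.ofReal ((p : ℝ)⁻¹ ^ j) := fun x j => by
    rw [measure_closedBall_inv_pow, ENNReal.ofReal_pow (by positivity),
      ENNReal.ofReal_inv_of_pos hp0, ENNReal.ofReal_natCast]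
  have hpow : ∀ ε : ℝ, 0 < ε → ε ≤ 1 →
      ∃ n : ℕ, (p : ℝ)⁻¹ ^ (n + 1) ≤ ε ∧ ε ≤ (p : ℝ)⁻¹ ^ n ∧
        (p : ℝ)⁻¹ ^ n = p * (p : ℝ)⁻¹ ^ (n + 1) := fun ε h0 h1 => by
    obtain ⟨n, hn1, hn2⟩ := exists_nat_pow_near_of_lt_one h0 h1 (inv_pos.2 hp0) hinv
    refine ⟨n, hn1.le, hn2, ?_⟩
    rw [pow_succ]
    field_simp
  refine ⟨⟨2 * (p : NNReal) ^ 2, ?_⟩⟩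
  filter_upwards [Ioc_mem_nhdsGT (show (0 : ℝ) < 1 / 2 by norm_num)] with ε hε x
  obtain ⟨b, hb1, hb2, hb3⟩ := hpow ε hε.1 (by linarith [hε.2])
  obtain ⟨n, hn1, hn2, hn3⟩ := hpow (2 * ε) (by linarith [hε.1]) (by linarith [hε.2])
  calc μ (closedBall x (2 * ε)) ≤ μ (closedBall x ((p : ℝ)⁻¹ ^ n)) :=
        measure_mono (closedBall_subset_closedBall hn2)
    _ = ENNReal.ofReal ((p : ℝ)⁻¹ ^ n) := hmeas x n
    _ ≤ ENNReal.ofReal (2 * (p : ℝ) ^ 2 * (p : ℝ)⁻¹ ^ (b + 1)) := by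
        refine ENNReal.ofReal_le_ofReal ?_
        calc (p : ℝ)⁻¹ ^ n = p * (p : ℝ)⁻¹ ^ (n + 1) := hn3
          _ ≤ p * (2 * ε) := by gcongr
          _ ≤ p * (2 * (p * (p : ℝ)⁻¹ ^ (b + 1))) := by
              rw [← hb3]
              gcongr
          _ = _ := by ring
    _ = 2 * (p : ℝ≥0∞) ^ 2 * μ (closedBall x ((p : ℝ)⁻¹ ^ (b + 1))) := by
        rw [hmeas, ENNReal.ofReal_mul (by positivity), ENNReal.ofReal_mul (by norm_num),
          ENNReal.ofReal_pow hp0.le, ENNReal.ofReal_natCast, ENNReal.ofReal_ofNat]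
    _ ≤ _ := by
        push_cast
        gcongr

lemma measurableEmbedding_add_pow_mul (c : ℤ_[p]) (j : ℕ) :
    MeasurableEmbedding fun z : ℤ_[p] => c + (p : ℤ_[p]) ^ j * z := by
  refine (Continuous.isClosedEmbedding (by fun_prop) ?_).measurableEmbedding
  intro z w h
  exact mul_left_cancel₀ (pow_ne_zero j natCast_p_ne_zero) (add_left_cancel h)

lemma measure_image_add_pow_mul (μ : Measure ℤ_[p]) [μ.IsAddHaarMeasure]
    [IsProbabilityMeasure μ] (c : ℤ_[p]) (j : ℕ) (A : Set ℤ_[p]) :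
    μ ((fun z : ℤ_[p] => c + (p : ℤ_[p]) ^ j * z) '' A) = (p : ℝ≥0∞)⁻¹ ^ j * μ A := by
  have hS := measurableEmbedding_add_pow_mul c j
  set S := fun z : ℤ_[p] => c + (p : ℤ_[p]) ^ j * z with hSdef
  have hp0 : (p : ℝ≥0∞) ≠ 0 := by exact_mod_cast (Fact.out : p.Prime).ne_zero
  have hcancel : (p : ℝ≥0∞)⁻¹ ^ j * (p : ℝ≥0∞) ^ j = 1 := by
    rw [← mul_pow, ENNReal.inv_mul_cancel hp0 (ENNReal.natCast_ne_top p), one_pow]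
  set ν : Measure ℤ_[p] := (p : ℝ≥0∞) ^ j • μ.comap S with hν
  have hνapp : ∀ B, ν B = (p : ℝ≥0∞) ^ j * μ (S '' B) := fun B => by
    rw [hν, Measure.smul_apply, hS.comap_apply, smul_eq_mul]
  have hprob : IsProbabilityMeasure ν := ⟨by
    rw [hνapp, Set.image_univ, range_add_pow_mul, measure_closedBall_inv_pow, mul_comm, hcancel]⟩
  have hinv : ν.IsAddLeftInvariant := ⟨fun g => by
    ext B hB
    rw [Measure.map_apply (measurable_const_add g) hB, hνapp, hνapp]
    congr 1
    rw [← measure_preimage_add μ ((p : ℤ_[p]) ^ j * g) (S '' B)]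
    congr 1
    ext y
    simp only [Set.mem_image, Set.mem_preimage, hSdef]
    constructor
    · rintro ⟨z, hz, rfl⟩
      exact ⟨g + z, hz, by ring⟩
    · rintro ⟨z, hz, hy⟩
      refine ⟨z - g, by simpa using hz, ?_⟩
      linear_combination hy⟩
  have hhaar : ν.IsAddHaarMeasure :=
    Measure.isAddHaarMeasure_of_isCompact_nonempty_interior ν Set.univ isCompact_univ
      (by simp) (by simp) (by simp)
  have heq : ν = μ := Measure.isAddHaarMeasure_eq_of_isProbabilityMeasure ν μ
  have happ := hνapp A
  rw [heq] at happ
  rw [happ, ← mul_assoc, hcancel, one_mul]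

/-- A set that is not enlarged in measure by the contractions `z ↦ c + p ^ j z` has measure
zero or one. -/
theorem measure_eq_one_of_preimage_le (μ : Measure ℤ_[p]) [μ.IsAddHaarMeasure]
    [IsProbabilityMeasure μ] {W : Set ℤ_[p]} (hW0 : μ W ≠ 0)
    (hW : ∀ j c : ℕ, c < p ^ j →
      μ ((fun z : ℤ_[p] => (c : ℤ_[p]) + (p : ℤ_[p]) ^ j * z) ⁻¹' W) ≤ μ W) : μ W = 1 := by
  have hdoub := isUnifLocDoublingMeasure_padicInt μ
  have hne : (ae (μ.restrict W)).NeBot := by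
    rw [ae_neBot]
    exact fun h => hW0 (Measure.restrict_eq_zero.1 h)
  obtain ⟨x, hx⟩ := (IsUnifLocDoublingMeasure.ae_tendsto_measure_inter_div μ W 1).exists
  have hp1 : 1 < p := (Fact.out : p.Prime).one_lt
  have hp0 : (0 : ℝ) < p := by positivity
  have hinv : (p : ℝ)⁻¹ < 1 := inv_lt_one_of_one_lt₀ (by exact_mod_cast hp1)
  have hδ : Tendsto (fun j : ℕ => (p : ℝ)⁻¹ ^ j) atTop (𝓝[>] 0) :=
    tendsto_nhdsWithin_iff.2 ⟨tendsto_pow_atTop_nhds_zero_of_lt_one (by positivity) hinv,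
      Eventually.of_forall fun j => Set.mem_Ioi.2 (by positivity)⟩
  have hlim := hx (fun _ : ℕ => x) _ hδ (Eventually.of_forall fun j =>
    mem_closedBall_self (by positivity))
  refine le_antisymm prob_le_one (le_of_tendsto' hlim fun j => ?_)
  obtain ⟨c, hc, hxc⟩ := exists_lt_mem_closedBall x j
  rw [closedBall_eq_of_mem hxc, measure_closedBall_inv_pow, ← range_add_pow_mul,
    ← Set.image_preimage_eq_inter_range, measure_image_add_pow_mul]
  refine ENNReal.div_le_of_le_mul ?_
  rw [mul_comm]
  exact mul_le_mul_left (hW j c hc) _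

end PadicMeasure

section ZeroOne

open scoped ENNReal Topology
open Metric

variable {p : ℕ} [Fact p.Prime]

/-- The `p`-adic integers `x` such that `|n x - a| ≤ r` for some reduced numerator `a` of `n`. -/
def padicApprox (p : ℕ) [Fact p.Prime] (n : ℕ) (r : ℝ) : Set ℤ_[p] :=
  {x | ∃ a ∈ reducedNumerators n, ‖(n : ℤ_[p]) * x - (a : ℤ_[p])‖ ≤ r}

lemma norm_natCast_eq_one {n : ℕ} (hn : ¬ p ∣ n) : ‖(n : ℤ_[p])‖ = 1 :=
  PadicInt.norm_natCast_eq_one_iff.2 ((Nat.Prime.coprime_iff_not_dvd Fact.out).2 hn)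

lemma norm_natCast_mul_sub {n : ℕ} (hn : ¬ p ∣ n) (x a : ℤ_[p]) :
    ‖(n : ℤ_[p]) * x - a‖ = dist x (a * (n : ℤ_[p]).inv) := by
  have h1 : (n : ℤ_[p]) * x - a = (n : ℤ_[p]) * (x - a * (n : ℤ_[p]).inv) := by
    linear_combination a * PadicInt.mul_inv (norm_natCast_eq_one hn)
  rw [h1, norm_mul, norm_natCast_eq_one hn, one_mul, dist_eq_norm]

lemma padicApprox_eq_cthickening {n : ℕ} (hn : ¬ p ∣ n) {r : ℝ} (hr : 0 ≤ r) :
    padicApprox p n r = cthickening r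
      ((fun a : ℤ => (a : ℤ_[p]) * (n : ℤ_[p]).inv) '' (reducedNumerators n : Set ℤ)) := by
  rw [((Finset.finite_toSet _).image _).isCompact.cthickening_eq_biUnion_closedBall hr]
  ext x
  simp only [padicApprox, Set.mem_ofPred_eq, norm_natCast_mul_sub hn, Set.biUnion_image,
    Set.mem_iUnion, mem_closedBall, Finset.mem_coe, exists_prop]

lemma exists_reducedNumerators_of_pow_dvd {p j c n : ℕ} {a : ℤ} (hc : c < p ^ j)
    (ha : a ∈ reducedNumerators n) (hd : (p : ℤ) ^ j ∣ a - c * n) :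
    ∃ b ∈ reducedNumerators n, a = c * n + (p : ℤ) ^ j * b := by
  obtain ⟨b, hb⟩ := hd
  have hab : a = c * n + (p : ℤ) ^ j * b := by linarith
  refine ⟨b, ?_, hab⟩
  rw [mem_reducedNumerators] at ha ⊢
  obtain ⟨ha1, ha2⟩ := ha
  have hc' : (c : ℤ) + 1 ≤ (p : ℤ) ^ j := by exact_mod_cast hc
  have hc0 : (0 : ℤ) ≤ c := Int.natCast_nonneg c
  have hpj : (0 : ℤ) < (p : ℤ) ^ j := by linarith
  have hn0 : (0 : ℤ) ≤ n := Int.natCast_nonneg n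
  refine ⟨?_, ?_⟩
  · rw [abs_le] at ha1 ⊢
    constructor
    · refine le_of_mul_le_mul_left ?_ hpj
      nlinarith
    · refine le_of_mul_le_mul_left ?_ hpj
      nlinarith
  · rw [← Int.isCoprime_iff_gcd_eq_one] at ha2 ⊢
    rw [hab, add_comm, IsCoprime.add_mul_right_left_iff] at ha2
    exact ha2.of_mul_left_right

lemma preimage_padicApprox_subset {n j c : ℕ} (hc : c < p ^ j) {r : ℝ}
    (hr : r ≤ (p : ℝ)⁻¹ ^ j) :
    (fun z : ℤ_[p] => (c : ℤ_[p]) + (p : ℤ_[p]) ^ j * z) ⁻¹' padicApprox p n r ⊆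
      padicApprox p n ((p : ℝ) ^ j * r) := by
  rintro z ⟨a, ha, hz⟩
  have hp0 : (0 : ℝ) < p := by exact_mod_cast (Fact.out : p.Prime).pos
  have hd : (p : ℤ) ^ j ∣ a - c * n := by
    rw [← norm_intCast_le_inv_pow_iff]
    have h1 : ((a - c * n : ℤ) : ℤ_[p]) = (p : ℤ_[p]) ^ j * (n * z) +
        -((n : ℤ_[p]) * (c + (p : ℤ_[p]) ^ j * z) - a) := by
      push_cast
      ring
    rw [h1]
    refine (PadicInt.nonarchimedean _ _).trans (max_le ?_ ?_)
    · rw [norm_mul, PadicInt.norm_p_pow, ← inv_natCast_pow_eq_zpow]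
      exact mul_le_of_le_one_right (by positivity) (PadicInt.norm_le_one _)
    · rw [norm_neg]
      exact hz.trans hr
  obtain ⟨b, hb, hab⟩ := exists_reducedNumerators_of_pow_dvd hc ha hd
  refine ⟨b, hb, ?_⟩
  have h2 : (n : ℤ_[p]) * (c + (p : ℤ_[p]) ^ j * z) - a = (p : ℤ_[p]) ^ j * (n * z - b) := by
    rw [hab]
    push_cast
    ring
  simp only [h2] at hz
  rw [norm_mul, PadicInt.norm_p_pow, ← inv_natCast_pow_eq_zpow, inv_pow,
    inv_mul_le_iff₀ (by positivity)] at hz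
  exact hz

variable [MeasurableSpace ℤ_[p]] [BorelSpace ℤ_[p]]

theorem measure_frequently_padicApprox_eq_one (μ : Measure ℤ_[p]) [μ.IsAddHaarMeasure]
    [IsProbabilityMeasure μ] {q : ℕ → Prop} (hq : ∀ n, q n → ¬ p ∣ n) {r : ℕ → ℝ}
    (hr0 : ∀ n, 0 ≤ r n) (hr : Tendsto r atTop (𝓝 0))
    (hpos : μ {x | ∃ᶠ n in atTop, q n ∧ x ∈ padicApprox p n (r n)} ≠ 0) :
    μ {x | ∃ᶠ n in atTop, q n ∧ x ∈ padicApprox p n (r n)} = 1 := by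
  have hp0 : (0 : ℝ) < p := by exact_mod_cast (Fact.out : p.Prime).pos
  refine measure_eq_one_of_preimage_le μ hpos fun j c hc => ?_
  have hdoub := isUnifLocDoublingMeasure_padicInt μ
  have hset : ∀ M : ℝ, 0 ≤ M → {x | ∃ᶠ n in atTop, q n ∧ x ∈ padicApprox p n (M * r n)} =
      blimsup (fun n => cthickening (M * r n) ((fun a : ℤ => (a : ℤ_[p]) * (n : ℤ_[p]).inv) ''
        (reducedNumerators n : Set ℤ))) atTop q := fun M hM => by
    ext x
    rw [← Nat.cofinite_eq_atTop, cofinite.blimsup_set_eq, Nat.cofinite_eq_atTop]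
    refine Iff.trans ?_ Nat.frequently_atTop_iff_infinite
    refine frequently_congr (Eventually.of_forall fun n => and_congr_right fun hn => ?_)
    rw [padicApprox_eq_cthickening (hq n hn) (mul_nonneg hM (hr0 n))]
  have hscale := blimsup_cthickening_mul_ae_eq μ q
    (fun n => (fun a : ℤ => (a : ℤ_[p]) * (n : ℤ_[p]).inv) '' (reducedNumerators n : Set ℤ))
    (M := (p : ℝ) ^ j) (by positivity) r hr
  have h1 := hset 1 zero_le_one
  simp only [one_mul] at h1
  rw [h1, ← measure_congr hscale, ← hset _ (by positivity), ← h1]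
  refine measure_mono fun z hz => ?_
  have hev : ∀ᶠ n in atTop, r n ≤ (p : ℝ)⁻¹ ^ j := hr.eventually (ge_mem_nhds (by positivity))
  refine (hz.and_eventually hev).mono fun n hn => ⟨hn.1.1, ?_⟩
  exact preimage_padicApprox_subset hc hn.2 hn.1.2

end ZeroOne

section CircleTransfer

open scoped ENNReal
open Metric

/-- The integers `1 ≤ a ≤ n` that are coprime to `n`. -/
def positiveNumerators (n : ℕ) : Finset ℤ := {a ∈ Finset.Icc 1 (n : ℤ) | Int.gcd a n = 1}

lemma mem_positiveNumerators {n : ℕ} {a : ℤ} :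
    a ∈ positiveNumerators n ↔ (1 ≤ a ∧ a ≤ n) ∧ Int.gcd a n = 1 := by
  simp [positiveNumerators]

/-- Pairs of reduced fractions with denominators `m` and `n` at circle distance at most `δ`. -/
def circlePairs (m n : ℕ) (δ : ℝ) : Finset (ℤ × ℤ) :=
  {x ∈ positiveNumerators m ×ˢ positiveNumerators n |
    ‖(((x.1 : ℝ) / m - (x.2 : ℝ) / n : ℝ) : UnitAddCircle)‖ ≤ δ}

lemma exists_positiveNumerators_of_coprime {P m : ℕ} (hm : 0 < m) (hP : Nat.Coprime P m) {a : ℤ}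
    (ha : a ∈ reducedNumerators m) :
    ∃ b ∈ positiveNumerators m, (m : ℤ) ∣ (P : ℤ) * b - a := by
  obtain ⟨u, v, huv⟩ := Nat.isCoprime_iff_coprime.2 hP
  have hm' : (0 : ℤ) < m := by exact_mod_cast hm
  set b := (u * a - 1) % m + 1 with hb
  have hdiv := Int.mul_ediv_add_emod (u * a - 1) m
  have hdvd : (m : ℤ) ∣ (P : ℤ) * b - a := by
    refine ⟨-(v * a) - P * ((u * a - 1) / m), ?_⟩
    have h1 : b = u * a - m * ((u * a - 1) / m) := by rw [hb]; linarith
    rw [h1]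
    linear_combination a * huv
  refine ⟨b, mem_positiveNumerators.2 ⟨⟨?_, ?_⟩, ?_⟩, hdvd⟩
  · have := Int.emod_nonneg (u * a - 1) hm'.ne'
    omega
  · have := Int.emod_lt_of_pos (u * a - 1) hm'
    omega
  · obtain ⟨t, ht⟩ := hdvd
    have ha2 := (mem_reducedNumerators.1 ha).2
    rw [← Int.isCoprime_iff_gcd_eq_one] at ha2 ⊢
    have h2 : a = (P : ℤ) * b + m * (-t) := by linarith
    rw [h2, IsCoprime.add_mul_left_left_iff] at ha2
    exact ha2.of_mul_left_right

lemma card_reducedNumerators_filter_dvd_le (m : ℕ) (hm : 0 < m) (c : ℤ) :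
    ({a ∈ reducedNumerators m | (m : ℤ) ∣ c - a}).card ≤ 3 := by
  have hm' : (0 : ℤ) < m := by exact_mod_cast hm
  refine le_trans (Finset.card_le_card (t := {c % m - m, c % m, c % m + m}) ?_)
    Finset.card_le_three
  intro a ha
  obtain ⟨ha1, t, ht⟩ := Finset.mem_filter.1 ha
  have ha2 := abs_le.1 (mem_reducedNumerators.1 ha1).1
  have h0 := Int.emod_nonneg c hm'.ne'
  have h1 := Int.emod_lt_of_pos c hm'
  have h2 := Int.mul_ediv_add_emod c m
  have h3 : a = c % m + m * (c / m - t) := by linarith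
  generalize c / m - t = s at h3
  have h4 : s < 2 := by
    by_contra h
    nlinarith
  have h5 : -2 < s := by
    by_contra h
    nlinarith
  simp only [Finset.mem_insert, Finset.mem_singleton]
  have : s = -1 ∨ s = 0 ∨ s = 1 := by omega
  rcases this with rfl | rfl | rfl
  · left; linarith
  · right; left; linarith
  · right; right; linarith

lemma norm_sub_div_le_of_pow_dvd {P m n : ℕ} (hm : 0 < m) (hn : 0 < n) (hP0 : 0 < P)
    (hPm : Nat.Coprime P m) (hPn : Nat.Coprime P n) {a b a' b' : ℤ}
    (ha : a ∈ reducedNumerators m) (hb : b ∈ reducedNumerators n)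
    (hd : (P : ℤ) ∣ a * n - b * m) (ha' : (m : ℤ) ∣ (P : ℤ) * a' - a)
    (hb' : (n : ℤ) ∣ (P : ℤ) * b' - b) :
    ‖(((a' : ℝ) / m - (b' : ℝ) / n : ℝ) : UnitAddCircle)‖ ≤ 2 / P := by
  obtain ⟨s, hs⟩ := ha'
  obtain ⟨t, ht⟩ := hb'
  have hcop : IsCoprime (P : ℤ) ((m : ℤ) * n) :=
    (Nat.isCoprime_iff_coprime.2 hPm).mul_right (Nat.isCoprime_iff_coprime.2 hPn)
  have hw : (P : ℤ) ∣ s - t := by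
    have h1 : (P : ℤ) ∣ (m * n : ℤ) * (s - t) := by
      have h2 : (m * n : ℤ) * (s - t) = P * (a' * n - b' * m) - (a * n - b * m) := by
        linear_combination (-(n : ℤ)) * hs + (m : ℤ) * ht
      rw [h2]
      exact dvd_sub (dvd_mul_right _ _) hd
    exact hcop.dvd_of_dvd_mul_left h1
  obtain ⟨w, hw⟩ := hw
  have hmR : (0 : ℝ) < m := by exact_mod_cast hm
  have hnR : (0 : ℝ) < n := by exact_mod_cast hn
  have hPR : (0 : ℝ) < P := by exact_mod_cast hP0
  have hsR : (P : ℝ) * a' - a = m * s := by exact_mod_cast hs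
  have htR : (P : ℝ) * b' - b = n * t := by exact_mod_cast ht
  have hwR : (s : ℝ) - t = P * w := by exact_mod_cast hw
  have heq : (a' : ℝ) / m - (b' : ℝ) / n - w = ((a : ℝ) / m - (b : ℝ) / n) / P := by
    have h1 : (a' : ℝ) = (a + m * s) / P := by field_simp; linarith
    have h2 : (b' : ℝ) = (b + n * t) / P := by field_simp; linarith
    have h3 : (s : ℝ) = t + P * w := by linarith
    rw [h1, h2, h3]
    field_simp
    ring
  have hbound : |(a : ℝ) / m - (b : ℝ) / n| ≤ 2 := by
    have h1 : |(a : ℝ) / m| ≤ 1 := by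
      rw [abs_div, abs_of_pos hmR, div_le_one hmR]
      exact_mod_cast (mem_reducedNumerators.1 ha).1
    have h2 : |(b : ℝ) / n| ≤ 1 := by
      rw [abs_div, abs_of_pos hnR, div_le_one hnR]
      exact_mod_cast (mem_reducedNumerators.1 hb).1
    linarith [abs_sub ((a : ℝ) / m) ((b : ℝ) / n)]
  rw [UnitAddCircle.norm_eq]
  calc _ ≤ |(a' : ℝ) / m - (b' : ℝ) / n - w| := round_le _ _
    _ ≤ 2 / P := by
      rw [heq, abs_div, abs_of_pos hPR]
      gcongr

lemma card_closePairs_le_card_circlePairs {p l m n : ℕ} (hp : p.Prime) (hm : 0 < m) (hn : 0 < n)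
    (hpm : ¬ p ∣ m) (hpn : ¬ p ∣ n) :
    (closePairs p l m n).card ≤ 9 * (circlePairs m n (2 / (p : ℝ) ^ l)).card := by
  have hPm : Nat.Coprime (p ^ l) m := ((Nat.Prime.coprime_iff_not_dvd hp).2 hpm).pow_left l
  have hPn : Nat.Coprime (p ^ l) n := ((Nat.Prime.coprime_iff_not_dvd hp).2 hpn).pow_left l
  have hP0 : 0 < p ^ l := pow_pos hp.pos l
  have hex : ∀ (k : ℕ) (a : ℤ), ∃ b : ℤ, 0 < k → Nat.Coprime (p ^ l) k →
      a ∈ reducedNumerators k → b ∈ positiveNumerators k ∧ (k : ℤ) ∣ ((p ^ l : ℕ) : ℤ) * b - a := by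
    intro k a
    by_cases h : 0 < k ∧ Nat.Coprime (p ^ l) k ∧ a ∈ reducedNumerators k
    · obtain ⟨b, hb⟩ := exists_positiveNumerators_of_coprime h.1 h.2.1 h.2.2
      exact ⟨b, fun _ _ _ => hb⟩
    · exact ⟨0, fun h1 h2 h3 => absurd ⟨h1, h2, h3⟩ h⟩
  choose f hf using hex
  refine Finset.card_le_mul_card_image_of_maps_to (f := fun x => (f m x.1, f n x.2)) ?_ 9 ?_
  · rintro ⟨a, b⟩ hx
    simp only [closePairs, Finset.mem_filter, Finset.mem_product] at hx
    obtain ⟨⟨ha, hb⟩, hd⟩ := hx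
    obtain ⟨ha1, ha2⟩ := hf m a hm hPm ha
    obtain ⟨hb1, hb2⟩ := hf n b hn hPn hb
    simp only [circlePairs, Finset.mem_filter, Finset.mem_product]
    refine ⟨⟨ha1, hb1⟩, ?_⟩
    have := norm_sub_div_le_of_pow_dvd hm hn hP0 hPm hPn ha hb (by exact_mod_cast hd) ha2 hb2
    exact_mod_cast this
  · rintro ⟨a', b'⟩ -
    have hsub : {x ∈ closePairs p l m n | (f m x.1, f n x.2) = (a', b')} ⊆
        {a ∈ reducedNumerators m | (m : ℤ) ∣ ((p ^ l : ℕ) : ℤ) * a' - a} ×ˢ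
          {b ∈ reducedNumerators n | (n : ℤ) ∣ ((p ^ l : ℕ) : ℤ) * b' - b} := by
      rintro ⟨a, b⟩ hx
      simp only [closePairs, Finset.mem_filter, Finset.mem_product, Prod.mk.injEq] at hx
      obtain ⟨⟨⟨ha, hb⟩, -⟩, rfl, rfl⟩ := hx
      simp only [Finset.mem_filter, Finset.mem_product]
      exact ⟨⟨ha, (hf m a hm hPm ha).2⟩, hb, (hf n b hn hPn hb).2⟩
    refine (Finset.card_le_card hsub).trans ?_
    rw [Finset.card_product]
    exact Nat.mul_le_mul (card_reducedNumerators_filter_dvd_le m hm _)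
      (card_reducedNumerators_filter_dvd_le n hn _)

lemma eq_of_norm_sub_div_lt {m : ℕ} (hm : 0 < m) {a b : ℤ} (ha : a ∈ positiveNumerators m)
    (hb : b ∈ positiveNumerators m)
    (h : ‖((((a : ℝ) / m : ℝ) : UnitAddCircle) - (((b : ℝ) / m : ℝ) : UnitAddCircle))‖ <
      1 / m) : a = b := by
  have hmR : (0 : ℝ) < m := by exact_mod_cast hm
  rw [← AddCircle.coe_sub, UnitAddCircle.norm_eq] at h
  set z := round ((a : ℝ) / m - (b : ℝ) / m)
  have h1 : |((a - b - z * m : ℤ) : ℝ)| < 1 := by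
    have h2 : ((a - b - z * m : ℤ) : ℝ) = ((a : ℝ) / m - (b : ℝ) / m - z) * m := by
      push_cast
      field_simp
    rw [h2, abs_mul, abs_of_pos hmR]
    rwa [lt_div_iff₀ hmR] at h
  have h3 : a - b - z * m = 0 := by
    rw [← Int.abs_lt_one_iff]
    exact_mod_cast h1
  have ha' := (mem_positiveNumerators.1 ha).1
  have hb' := (mem_positiveNumerators.1 hb).1
  have h4 := Int.eq_zero_of_abs_lt_dvd (m := (m : ℤ)) (x := a - b) ⟨z, by linarith⟩
    (abs_lt.2 ⟨by omega, by omega⟩)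
  omega

lemma mem_circleA_of_norm_le {ψ : ℕ → ℝ} {n : ℕ} {a : ℤ} (ha : a ∈ positiveNumerators n)
    {x : UnitAddCircle} (hx : ‖x - (((a : ℝ) / n : ℝ) : UnitAddCircle)‖ ≤ ψ n) :
    x ∈ circleA ψ n := by
  obtain ⟨⟨h1, h2⟩, h3⟩ := mem_positiveNumerators.1 ha
  lift a to ℕ using by omega
  exact ⟨a, by omega, by omega, by simpa using h3, by simpa using hx⟩

lemma card_circlePairs_mul_le_volume {ψ : ℕ → ℝ} {m n : ℕ} (hm : 0 < m) (hn : 0 < n)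
    (hm0 : 0 ≤ ψ m) (hmn : ψ m ≤ ψ n) (hψm : ψ m < 1 / (2 * m)) (hψn : ψ n < 1 / (2 * n)) :
    ((circlePairs m n (ψ n / 2)).card : ℝ≥0∞) * ENNReal.ofReal (ψ m) ≤
      volume (circleA ψ m ∩ circleA ψ n) := by
  set B : ℤ × ℤ → Set UnitAddCircle := fun x =>
    closedBall (((x.1 : ℝ) / m : ℝ) : UnitAddCircle) (ψ m / 2)
  have hmR : (1 : ℝ) ≤ m := by exact_mod_cast hm
  have hm2 : 2 * (1 / (2 * (m : ℝ))) = 1 / m := by field_simp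
  have hn2 : 2 * (1 / (2 * (n : ℝ))) = 1 / n := by field_simp
  have hclose : ∀ x ∈ circlePairs m n (ψ n / 2), ∀ y ∈ B x,
      ‖y - (((x.1 : ℝ) / m : ℝ) : UnitAddCircle)‖ ≤ ψ m / 2 ∧
      ‖y - (((x.2 : ℝ) / n : ℝ) : UnitAddCircle)‖ ≤ ψ n := by
    intro x hx y hy
    have h1 : ‖y - (((x.1 : ℝ) / m : ℝ) : UnitAddCircle)‖ ≤ ψ m / 2 := by
      rwa [← dist_eq_norm]
    refine ⟨h1, ?_⟩
    have h2 := (Finset.mem_filter.1 hx).2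
    rw [AddCircle.coe_sub] at h2
    have h3 := norm_sub_le_norm_sub_add_norm_sub y (((x.1 : ℝ) / m : ℝ) : UnitAddCircle)
      (((x.2 : ℝ) / n : ℝ) : UnitAddCircle)
    linarith
  have hdisj : (circlePairs m n (ψ n / 2) : Set (ℤ × ℤ)).PairwiseDisjoint B := by
    intro x hx y hy hxy
    refine Set.disjoint_left.2 fun z hzx hzy => hxy ?_
    have hx' := Finset.mem_product.1 (Finset.mem_filter.1 (Finset.mem_coe.1 hx)).1
    have hy' := Finset.mem_product.1 (Finset.mem_filter.1 (Finset.mem_coe.1 hy)).1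
    obtain ⟨h1, h2⟩ := hclose x hx z hzx
    obtain ⟨h3, h4⟩ := hclose y hy z hzy
    rw [norm_sub_rev] at h1 h2
    refine Prod.ext (eq_of_norm_sub_div_lt hm hx'.1 hy'.1 ?_)
      (eq_of_norm_sub_div_lt hn hx'.2 hy'.2 ?_)
    · refine (norm_sub_le_norm_sub_add_norm_sub _ z _).trans_lt ?_
      linarith
    · refine (norm_sub_le_norm_sub_add_norm_sub _ z _).trans_lt ?_
      linarith
  have hvol : ∀ x, volume (B x) = ENNReal.ofReal (ψ m) := fun x => by
    rw [AddCircle.volume_closedBall]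
    congr 1
    rw [mul_div_cancel₀ _ (two_ne_zero)]
    refine min_eq_right (hψm.le.trans ?_)
    rw [div_le_one (by positivity)]
    linarith
  calc _ = ∑ x ∈ circlePairs m n (ψ n / 2), volume (B x) := by
        simp only [hvol, Finset.sum_const, nsmul_eq_mul]
    _ = volume (⋃ x ∈ circlePairs m n (ψ n / 2), B x) :=
        (measure_biUnion_finset hdisj fun x _ => isClosed_closedBall.measurableSet).symm
    _ ≤ _ := by
        refine measure_mono (Set.iUnion₂_subset fun x hx y hy => ?_)
        obtain ⟨h1, h2⟩ := hclose x hx y hy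
        have hx' := Finset.mem_product.1 (Finset.mem_filter.1 hx).1
        exact ⟨mem_circleA_of_norm_le hx'.1 (by linarith), mem_circleA_of_norm_le hx'.2 h2⟩

lemma volume_circleA_le (ψ : ℕ → ℝ) (n : ℕ) :
    volume (circleA ψ n) ≤
      ((reducedNumerators n).card : ℝ≥0∞) * ENNReal.ofReal (2 * ψ n) := by
  have hsub : circleA ψ n ⊆ ⋃ a ∈ reducedNumerators n,
      closedBall (((a : ℝ) / n : ℝ) : UnitAddCircle) (ψ n) := by
    rintro x ⟨a, h1, h2, h3, hx⟩
    refine Set.mem_biUnion (x := (a : ℤ)) (Finset.mem_coe.2 (mem_reducedNumerators.2 ⟨?_, ?_⟩)) ?_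
    · rw [Nat.abs_cast]
      exact_mod_cast h2
    · simpa using h3
    · rw [mem_closedBall, dist_eq_norm]
      simpa using hx
  refine (measure_mono hsub).trans ((measure_biUnion_finset_le _ _).trans ?_)
  rw [← nsmul_eq_mul]
  refine Finset.sum_le_card_nsmul _ _ _ fun a _ => ?_
  rw [AddCircle.volume_closedBall]
  exact ENNReal.ofReal_le_ofReal (min_le_right _ _)

end CircleTransfer

section CountingFunctions

open scoped ENNReal
open Metric

variable {p : ℕ} [Fact p.Prime]

/-- The number of reduced fractions `a / n` within `p`-adic distance `p ^ (-k)` of `x`. -/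
def padicCount (p : ℕ) [Fact p.Prime] (n k : ℕ) (x : ℤ_[p]) : ℝ≥0∞ :=
  ∑ a ∈ reducedNumerators n,
    (closedBall ((a : ℤ_[p]) * (n : ℤ_[p]).inv) ((p : ℝ)⁻¹ ^ k)).indicator 1 x

lemma mem_padicApprox_of_padicCount_ne_zero {n k : ℕ} (hn : ¬ p ∣ n) {x : ℤ_[p]}
    (hx : padicCount p n k x ≠ 0) : x ∈ padicApprox p n ((p : ℝ)⁻¹ ^ k) := by
  obtain ⟨a, ha, hax⟩ := Finset.exists_ne_zero_of_sum_ne_zero hx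
  refine ⟨a, ha, ?_⟩
  rw [norm_natCast_mul_sub hn]
  exact mem_closedBall.1 (Set.mem_of_indicator_ne_zero hax)

lemma pow_dvd_of_mem_closedBall {m n k l j : ℕ} (hm : ¬ p ∣ m) (hn : ¬ p ∣ n) {a b : ℤ}
    {x : ℤ_[p]} (ha : x ∈ closedBall ((a : ℤ_[p]) * (m : ℤ_[p]).inv) ((p : ℝ)⁻¹ ^ k))
    (hb : x ∈ closedBall ((b : ℤ_[p]) * (n : ℤ_[p]).inv) ((p : ℝ)⁻¹ ^ l))
    (hk : j ≤ k) (hl : j ≤ l) : (p : ℤ) ^ j ∣ a * n - b * m := by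
  have hp1 : (1 : ℝ) ≤ p := by exact_mod_cast (Fact.out : p.Prime).one_le
  have hinv : (p : ℝ)⁻¹ ≤ 1 := inv_le_one_of_one_le₀ hp1
  rw [mem_closedBall, ← norm_natCast_mul_sub hm] at ha
  rw [mem_closedBall, ← norm_natCast_mul_sub hn] at hb
  rw [← norm_intCast_le_inv_pow_iff]
  have h1 : ((a * n - b * m : ℤ) : ℤ_[p]) =
      (m : ℤ_[p]) * (n * x - b) + -((n : ℤ_[p]) * (m * x - a)) := by
    push_cast
    ring
  rw [h1]
  refine (PadicInt.nonarchimedean _ _).trans (max_le ?_ ?_)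
  · rw [norm_mul, norm_natCast_eq_one hm, one_mul]
    exact hb.trans (pow_le_pow_of_le_one (by positivity) hinv hl)
  · rw [norm_neg, norm_mul, norm_natCast_eq_one hn, one_mul]
    exact ha.trans (pow_le_pow_of_le_one (by positivity) hinv hk)

variable [MeasurableSpace ℤ_[p]] [BorelSpace ℤ_[p]]

lemma measurable_padicCount (n k : ℕ) : Measurable (padicCount p n k) :=
  Finset.measurable_fun_sum _ fun _ _ => measurable_one.indicator isClosed_closedBall.measurableSet

variable (μ : Measure ℤ_[p]) [μ.IsAddHaarMeasure] [IsProbabilityMeasure μ]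

lemma lintegral_padicCount (n k : ℕ) :
    ∫⁻ x, padicCount p n k x ∂μ = (reducedNumerators n).card * (p : ℝ≥0∞)⁻¹ ^ k := by
  unfold padicCount
  rw [lintegral_finsetSum _ fun _ _ => measurable_one.indicator isClosed_closedBall.measurableSet]
  simp only [lintegral_indicator_one isClosed_closedBall.measurableSet,
    measure_closedBall_inv_pow, Finset.sum_const, nsmul_eq_mul]

lemma measure_closedBall_inter_le (c d : ℤ_[p]) (k l : ℕ) :
    μ (closedBall c ((p : ℝ)⁻¹ ^ k) ∩ closedBall d ((p : ℝ)⁻¹ ^ l)) ≤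
      (p : ℝ≥0∞)⁻¹ ^ max k l := by
  rcases max_choice k l with h | h
  · rw [h, ← measure_closedBall_inv_pow μ c k]
    exact measure_mono Set.inter_subset_left
  · rw [h, ← measure_closedBall_inv_pow μ d l]
    exact measure_mono Set.inter_subset_right

lemma lintegral_padicCount_mul_le {m n : ℕ} (hm : ¬ p ∣ m) (hn : ¬ p ∣ n) (k l : ℕ) :
    ∫⁻ x, padicCount p m k x * padicCount p n l x ∂μ ≤
      (closePairs p (min k l) m n).card * (p : ℝ≥0∞)⁻¹ ^ max k l := by
  have hmeas : ∀ (c : ℤ_[p]) (r : ℝ), MeasurableSet (closedBall c r) := fun c r =>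
    isClosed_closedBall.measurableSet
  have h1 : ∀ x, padicCount p m k x * padicCount p n l x =
      ∑ y ∈ reducedNumerators m ×ˢ reducedNumerators n,
        (closedBall ((y.1 : ℤ_[p]) * (m : ℤ_[p]).inv) ((p : ℝ)⁻¹ ^ k) ∩
          closedBall ((y.2 : ℤ_[p]) * (n : ℤ_[p]).inv) ((p : ℝ)⁻¹ ^ l)).indicator 1 x := by
    intro x
    rw [padicCount, padicCount, Finset.sum_mul_sum, ← Finset.sum_product']
    refine Finset.sum_congr rfl fun y _ => ?_
    rw [Set.inter_indicator_one]
    rfl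
  simp_rw [h1]
  rw [lintegral_finsetSum _ fun y _ =>
    measurable_one.indicator ((hmeas _ _).inter (hmeas _ _))]
  simp only [lintegral_indicator_one ((hmeas _ _).inter (hmeas _ _))]
  rw [← Finset.sum_filter_add_sum_filter_not _ fun y : ℤ × ℤ =>
    (p : ℤ) ^ min k l ∣ y.1 * n - y.2 * m]
  have h2 : ∑ y ∈ reducedNumerators m ×ˢ reducedNumerators n with
      ¬ (p : ℤ) ^ min k l ∣ y.1 * n - y.2 * m,
      μ (closedBall ((y.1 : ℤ_[p]) * (m : ℤ_[p]).inv) ((p : ℝ)⁻¹ ^ k) ∩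
          closedBall ((y.2 : ℤ_[p]) * (n : ℤ_[p]).inv) ((p : ℝ)⁻¹ ^ l)) = 0 := by
    refine Finset.sum_eq_zero fun y hy => ?_
    have hempty : closedBall ((y.1 : ℤ_[p]) * (m : ℤ_[p]).inv) ((p : ℝ)⁻¹ ^ k) ∩
        closedBall ((y.2 : ℤ_[p]) * (n : ℤ_[p]).inv) ((p : ℝ)⁻¹ ^ l) = ∅ :=
      Set.eq_empty_of_forall_notMem fun x hx => (Finset.mem_filter.1 hy).2
        (pow_dvd_of_mem_closedBall hm hn hx.1 hx.2 (min_le_left k l) (min_le_right k l))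
    rw [hempty, measure_empty]
  rw [h2, add_zero, ← nsmul_eq_mul]
  exact Finset.sum_le_card_nsmul _ _ _ fun y _ => measure_closedBall_inter_le μ _ _ k l

end CountingFunctions

section Divergence

open scoped ENNReal Topology
open Metric

lemma not_dvd_zero_of {p : ℕ} {q : ℕ → Prop} (hq : ∀ n, q n → ¬ p ∣ n) : ¬ q 0 :=
  fun h => hq 0 h (dvd_zero p)

lemma pos_of_not_dvd {p n : ℕ} (h : ¬ p ∣ n) : 0 < n :=
  Nat.pos_of_ne_zero fun h0 => h (h0 ▸ dvd_zero p)

variable {p : ℕ} [Fact p.Prime]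

lemma card_closePairs_le_ennreal {l m n : ℕ} (hm : ¬ p ∣ m) (hn : ¬ p ∣ n)
    (hlm : p ^ l ≤ 8 * m) (hln : p ^ l ≤ 8 * n) :
    ((closePairs p l m n).card : ℝ≥0∞) ≤
      (if m = n then ((reducedNumerators m).card : ℝ≥0∞) else 0) +
        ENNReal.ofReal (192 * Real.exp 13) * ((reducedNumerators m).card *
          (reducedNumerators n).card * (p : ℝ≥0∞)⁻¹ ^ l) := by
  have hpp : p.Prime := Fact.out
  have hp0 : (0 : ℝ) < p := by exact_mod_cast hpp.pos
  have h1 := card_closePairs_le hpp hm (pos_of_not_dvd hm) (pos_of_not_dvd hn) hlm hln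
  have h2 : ((closePairs p l m n).card : ℝ) ≤
      (if m = n then ((reducedNumerators m).card : ℝ) else 0) +
        192 * Real.exp 13 * ((reducedNumerators m).card *
          (reducedNumerators n).card * (p : ℝ)⁻¹ ^ l) := by
    refine h1.trans ?_
    rw [inv_pow, ← div_eq_mul_inv]
    gcongr
    · exact_mod_cast totient_le_card_reducedNumerators (n := m)
    · exact_mod_cast totient_le_card_reducedNumerators (n := n)
  have h3 := ENNReal.ofReal_le_ofReal h2
  rw [ENNReal.ofReal_natCast] at h3
  refine h3.trans ?_
  refine ENNReal.ofReal_add_le.trans (add_le_add ?_ ?_)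
  · split_ifs <;> simp
  · rw [ENNReal.ofReal_mul (p := 192 * Real.exp 13) (by positivity),
      ENNReal.ofReal_mul (q := (p : ℝ)⁻¹ ^ l) (by positivity),
      ENNReal.ofReal_mul (Nat.cast_nonneg _), ENNReal.ofReal_natCast, ENNReal.ofReal_natCast,
      ENNReal.ofReal_pow (by positivity), ENNReal.ofReal_inv_of_pos hp0, ENNReal.ofReal_natCast]

/-- The counting function restricted to the denominators satisfying `q`. -/
def selectedCount (p : ℕ) [Fact p.Prime] (q : ℕ → Prop) (k : ℕ → ℕ) (n : ℕ) : ℤ_[p] → ℝ≥0∞ :=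
  open Classical in if q n then padicCount p n (k n) else 0

lemma selectedCount_of_pos {q : ℕ → Prop} {k : ℕ → ℕ} {n : ℕ} (h : q n) :
    selectedCount p q k n = padicCount p n (k n) := if_pos h

lemma selectedCount_of_neg {q : ℕ → Prop} {k : ℕ → ℕ} {n : ℕ} (h : ¬ q n) :
    selectedCount p q k n = 0 := if_neg h

lemma card_closePairs_mul_le_volume {ψ : ℕ → ℝ} {m n k l : ℕ} (hm : ¬ p ∣ m) (hn : ¬ p ∣ n)
    (hk : 8 * m < p ^ k) (hl : 8 * n < p ^ l) (hlk : l ≤ k)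
    (hψm : ψ m = 4 * (p : ℝ)⁻¹ ^ k) (hψn : ψ n = 4 * (p : ℝ)⁻¹ ^ l) :
    ((closePairs p l m n).card : ℝ≥0∞) * (p : ℝ≥0∞)⁻¹ ^ k ≤
      9 * volume (circleA ψ m ∩ circleA ψ n) := by
  have hpp : p.Prime := Fact.out
  have hp0 : (0 : ℝ) < p := by exact_mod_cast hpp.pos
  have hinv : (p : ℝ)⁻¹ ≤ 1 := inv_le_one_of_one_le₀ (by exact_mod_cast hpp.one_le)
  have hsmall : ∀ {t j : ℕ}, ¬ p ∣ t → 8 * t < p ^ j → 4 * (p : ℝ)⁻¹ ^ j < 1 / (2 * t) := by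
    intro t j ht hj
    have ht0 : (0 : ℝ) < t := by exact_mod_cast pos_of_not_dvd ht
    have hj' : 8 * (t : ℝ) < (p : ℝ) ^ j := by exact_mod_cast hj
    rw [inv_pow, ← div_eq_mul_inv, div_lt_div_iff₀ (by positivity) (by positivity)]
    linarith
  have h1 : ψ n / 2 = 2 / (p : ℝ) ^ l := by
    rw [hψn, inv_pow]
    ring
  have h2 := card_circlePairs_mul_le_volume (ψ := ψ) (pos_of_not_dvd hm) (pos_of_not_dvd hn)
    (by rw [hψm]; positivity)
    (by rw [hψm, hψn]; gcongr 4 * ?_; exact pow_le_pow_of_le_one (by positivity) hinv hlk)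
    (by rw [hψm]; exact hsmall hm hk) (by rw [hψn]; exact hsmall hn hl)
  have h3 : (p : ℝ≥0∞)⁻¹ ^ k ≤ ENNReal.ofReal (ψ m) := by
    rw [hψm]
    refine le_trans (le_of_eq ?_)
      (ENNReal.ofReal_le_ofReal (le_mul_of_one_le_left (by positivity) (by norm_num)))
    rw [ENNReal.ofReal_pow (by positivity), ENNReal.ofReal_inv_of_pos hp0, ENNReal.ofReal_natCast]
  have h4 : ((closePairs p l m n).card : ℝ≥0∞) ≤ 9 * (circlePairs m n (ψ n / 2)).card := by
    rw [h1]
    exact_mod_cast card_closePairs_le_card_circlePairs (l := l) hpp (pos_of_not_dvd hm)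
      (pos_of_not_dvd hn) hm hn
  calc _ ≤ 9 * ((circlePairs m n (ψ n / 2)).card : ℝ≥0∞) * ENNReal.ofReal (ψ m) := by gcongr
    _ = 9 * (((circlePairs m n (ψ n / 2)).card : ℝ≥0∞) * ENNReal.ofReal (ψ m)) := by ring
    _ ≤ _ := by gcongr

lemma card_reducedNumerators_le_card_closePairs (p l n : ℕ) :
    (reducedNumerators n).card ≤ (closePairs p l n n).card := by
  refine Finset.card_le_card_of_injOn (fun a => (a, a)) (fun a ha => ?_)
    fun a _ b _ h => (Prod.ext_iff.1 h).1
  simp only [closePairs, Finset.coe_filter, Finset.mem_product, Set.mem_ofPred_eq]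
  exact ⟨⟨ha, ha⟩, by simp⟩

variable [MeasurableSpace ℤ_[p]] [BorelSpace ℤ_[p]]
variable (μ : Measure ℤ_[p]) [μ.IsAddHaarMeasure] [IsProbabilityMeasure μ]

lemma lintegral_padicCount_mul_le_of_overlap {m n k l : ℕ} (hm : ¬ p ∣ m) (hn : ¬ p ∣ n)
    (hkm : p ^ k ≤ 8 * m) (hln : p ^ l ≤ 8 * n) (hkl : m = n → k = l) :
    ∫⁻ x, padicCount p m k x * padicCount p n l x ∂μ ≤
      (if m = n then ∫⁻ x, padicCount p m k x ∂μ else 0) +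
        ENNReal.ofReal (192 * Real.exp 13) *
          ((∫⁻ x, padicCount p m k x ∂μ) * ∫⁻ x, padicCount p n l x ∂μ) := by
  have hp0 : 0 < p := (Fact.out : p.Prime).pos
  have h1 := card_closePairs_le_ennreal (l := min k l) hm hn
    ((Nat.pow_le_pow_right hp0 (min_le_left k l)).trans hkm)
    ((Nat.pow_le_pow_right hp0 (min_le_right k l)).trans hln)
  refine (lintegral_padicCount_mul_le μ hm hn k l).trans ?_
  refine (mul_le_mul_left h1 _).trans ?_
  rw [add_mul, lintegral_padicCount, lintegral_padicCount]
  refine add_le_add ?_ (le_of_eq ?_)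
  · split_ifs with h
    · rw [← hkl h, max_self]
    · simp
  · have h2 : (p : ℝ≥0∞)⁻¹ ^ min k l * (p : ℝ≥0∞)⁻¹ ^ max k l =
        (p : ℝ≥0∞)⁻¹ ^ k * (p : ℝ≥0∞)⁻¹ ^ l := by
      rw [← pow_add, ← pow_add, min_add_max]
    calc _ = ENNReal.ofReal (192 * Real.exp 13) * ((reducedNumerators m).card *
          (reducedNumerators n).card *
            ((p : ℝ≥0∞)⁻¹ ^ min k l * (p : ℝ≥0∞)⁻¹ ^ max k l)) := by ring
      _ = _ := by rw [h2]; ring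

lemma measurable_selectedCount (q : ℕ → Prop) (k : ℕ → ℕ) (n : ℕ) :
    Measurable (selectedCount p q k n) := by
  by_cases h : q n
  · rw [selectedCount_of_pos h]
    exact measurable_padicCount n (k n)
  · rw [selectedCount_of_neg h]
    exact measurable_zero

lemma lintegral_selectedCount_ne_top (q : ℕ → Prop) (k : ℕ → ℕ) (n : ℕ) :
    ∫⁻ x, selectedCount p q k n x ∂μ ≠ ∞ := by
  by_cases h : q n
  · rw [selectedCount_of_pos h, lintegral_padicCount]
    have hp0 : (p : ℝ≥0∞) ≠ 0 := by exact_mod_cast (Fact.out : p.Prime).ne_zero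
    exact ENNReal.mul_ne_top (ENNReal.natCast_ne_top _)
      (ENNReal.pow_ne_top (ENNReal.inv_ne_top.2 hp0))
  · rw [selectedCount_of_neg h]
    simp

lemma frequently_sum_lintegral_le_of_overlap {q : ℕ → Prop} (hq : ∀ n, q n → ¬ p ∣ n)
    {k : ℕ → ℕ} (hk : ∀ n, q n → p ^ k n ≤ 8 * n)
    (hdiv : ∑' n, ∫⁻ x, selectedCount p q k n x ∂μ = ∞) :
    ∃ C : ℝ≥0∞, C ≠ ∞ ∧ ∃ᶠ N in atTop, ∑ m ∈ Finset.range N, ∑ n ∈ Finset.range N,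
      ∫⁻ x, selectedCount p q k m x * selectedCount p q k n x ∂μ ≤
        C * (∑ n ∈ Finset.range N, ∫⁻ x, selectedCount p q k n x ∂μ) ^ 2 := by
  set D := ENNReal.ofReal (192 * Real.exp 13) with hD
  set u : ℕ → ℝ≥0∞ := fun n => ∫⁻ x, selectedCount p q k n x ∂μ with hu
  have hpair : ∀ m n, ∫⁻ x, selectedCount p q k m x * selectedCount p q k n x ∂μ ≤
      (if m = n then u m else 0) + D * (u m * u n) := by
    intro m n
    by_cases hm : q m
    · by_cases hn : q n
      · simp only [hu, selectedCount_of_pos hm, selectedCount_of_pos hn]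
        exact lintegral_padicCount_mul_le_of_overlap μ (hq m hm) (hq n hn) (hk m hm) (hk n hn)
          fun h => h ▸ rfl
      · simp [selectedCount_of_neg hn]
    · simp [selectedCount_of_neg hm]
  refine ⟨1 + D, by finiteness, Eventually.frequently ?_⟩
  have htend : Tendsto (fun N => ∑ n ∈ Finset.range N, u n) atTop (𝓝 ∞) := by
    have := ENNReal.summable.hasSum.tendsto_sum_nat (f := u)
    rwa [hdiv] at this
  filter_upwards [htend.eventually (lt_mem_nhds ENNReal.one_lt_top)] with N hN
  set S := ∑ n ∈ Finset.range N, u n with hS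
  calc _ ≤ ∑ m ∈ Finset.range N, ∑ n ∈ Finset.range N,
        ((if m = n then u m else 0) + D * (u m * u n)) :=
        Finset.sum_le_sum fun m _ => Finset.sum_le_sum fun n _ => hpair m n
    _ = S + D * S ^ 2 := by
        simp only [Finset.sum_add_distrib]
        congr 1
        · refine Finset.sum_congr rfl fun m hm => ?_
          rw [Finset.sum_ite_eq, if_pos hm]
        · rw [sq, hS, Finset.sum_mul_sum, Finset.mul_sum]
          exact Finset.sum_congr rfl fun m _ => (Finset.mul_sum _ _ _).symm
    _ ≤ S ^ 2 + D * S ^ 2 := by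
        gcongr
        rw [sq]
        exact le_mul_of_one_le_left' hN.le
    _ = _ := by ring

lemma frequently_sum_lintegral_le_of_disjoint (hQIA : QIAinftyHolds) {q : ℕ → Prop}
    (hq : ∀ n, q n → ¬ p ∣ n) {k : ℕ → ℕ} (hk : ∀ n, q n → 8 * n < p ^ k n)
    (hdiv : ∑' n, ∫⁻ x, selectedCount p q k n x ∂μ = ∞) :
    ∃ C : ℝ≥0∞, C ≠ ∞ ∧ ∃ᶠ N in atTop, ∑ m ∈ Finset.range N, ∑ n ∈ Finset.range N,
      ∫⁻ x, selectedCount p q k m x * selectedCount p q k n x ∂μ ≤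
        C * (∑ n ∈ Finset.range N, ∫⁻ x, selectedCount p q k n x ∂μ) ^ 2 := by
  classical
  have hp0 : (0 : ℝ) < p := by exact_mod_cast (Fact.out : p.Prime).pos
  set ψ : ℕ → ℝ := fun n => if q n then 4 * (p : ℝ)⁻¹ ^ k n else 0 with hψ
  have hψq : ∀ n, q n → ψ n = 4 * (p : ℝ)⁻¹ ^ k n := fun n h => if_pos h
  set u : ℕ → ℝ≥0∞ := fun n => ∫⁻ x, selectedCount p q k n x ∂μ with hu
  have hpair' : ∀ m n, q m → q n → k n ≤ k m →
      ∫⁻ x, selectedCount p q k m x * selectedCount p q k n x ∂μ ≤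
        9 * volume (circleA ψ m ∩ circleA ψ n) := by
    intro m n hm hn hkk
    simp only [selectedCount_of_pos hm, selectedCount_of_pos hn]
    refine (lintegral_padicCount_mul_le μ (hq m hm) (hq n hn) _ _).trans ?_
    rw [min_eq_right hkk, max_eq_left hkk]
    exact card_closePairs_mul_le_volume (hq m hm) (hq n hn) (hk m hm) (hk n hn) hkk
      (hψq m hm) (hψq n hn)
  have hpair : ∀ m n, ∫⁻ x, selectedCount p q k m x * selectedCount p q k n x ∂μ ≤
      9 * volume (circleA ψ m ∩ circleA ψ n) := by
    intro m n
    by_cases hm : q m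
    · by_cases hn : q n
      · rcases le_total (k n) (k m) with h | h
        · exact hpair' m n hm hn h
        · have := hpair' n m hn hm h
          rw [Set.inter_comm]
          simpa only [mul_comm] using this
      · simp [selectedCount_of_neg hn]
    · simp [selectedCount_of_neg hm]
  have hlow : ∀ n, u n ≤ 9 * volume (circleA ψ n) := by
    intro n
    by_cases hn : q n
    · simp only [hu, selectedCount_of_pos hn, lintegral_padicCount]
      have h1 := card_closePairs_mul_le_volume (hq n hn) (hq n hn) (hk n hn) (hk n hn) le_rfl
        (hψq n hn) (hψq n hn)
      rw [Set.inter_self] at h1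
      refine le_trans ?_ h1
      gcongr
      exact card_reducedNumerators_le_card_closePairs p (k n) n
    · simp [hu, selectedCount_of_neg hn]
  have hupp : ∀ n, volume (circleA ψ n) ≤ 8 * u n := by
    intro n
    refine (volume_circleA_le ψ n).trans ?_
    by_cases hn : q n
    · simp only [hu, selectedCount_of_pos hn, lintegral_padicCount]
      rw [hψq n hn, ← mul_assoc, ENNReal.ofReal_mul (by norm_num),
        ENNReal.ofReal_pow (by positivity), ENNReal.ofReal_inv_of_pos hp0,
        ENNReal.ofReal_natCast]
      refine le_of_eq ?_
      norm_num
      ring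
    · simp [hψ, hn]
  have hAdiv : ∑' n, volume (circleA ψ n) = ∞ := by
    have h1 : ∑' n, u n ≤ 9 * ∑' n, volume (circleA ψ n) := by
      rw [← ENNReal.tsum_mul_left]
      exact ENNReal.tsum_le_tsum hlow
    rw [hdiv, top_le_iff] at h1
    by_contra h
    exact ENNReal.mul_ne_top (by norm_num) h h1
  have hψ0 : ∀ n, 0 ≤ ψ n := fun n => by
    simp only [hψ]
    split_ifs <;> positivity
  obtain ⟨ε, hε0, hε⟩ := exists_between (hQIA ψ hψ0 hAdiv)
  have hεt : ε ≠ ∞ := hε.ne_top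
  have hfreq := frequently_lt_of_lt_limsup (by isBoundedDefault) hε
  have hC : 9 * (ε⁻¹ * 64) ≠ ∞ :=
    ENNReal.mul_ne_top (by norm_num)
      (ENNReal.mul_ne_top (ENNReal.inv_ne_top.2 hε0.ne') (by norm_num))
  refine ⟨9 * (ε⁻¹ * 64), hC, ?_⟩
  refine (tendsto_add_atTop_nat 1).frequently (hfreq.mono fun N hN => ?_)
  have hsub : Finset.Icc 1 N ⊆ Finset.range (N + 1) := fun n hn => by
    rw [Finset.mem_Icc] at hn
    exact Finset.mem_range.2 (by omega)
  have hzero : ∀ n ∈ Finset.range (N + 1), n ∉ Finset.Icc 1 N → n = 0 := fun n hn hn' => by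
    rw [Finset.mem_Icc] at hn'
    rw [Finset.mem_range] at hn
    omega
  have hs0 : selectedCount p q k 0 = 0 := selectedCount_of_neg (not_dvd_zero_of hq)
  have hY := ENNReal.mul_le_of_le_div hN.le
  set Y := ∑ m ∈ Finset.Icc 1 N, ∑ n ∈ Finset.Icc 1 N, volume (circleA ψ m ∩ circleA ψ n)
  set X := ∑ n ∈ Finset.Icc 1 N, volume (circleA ψ n)
  have hX : X ≤ 8 * ∑ n ∈ Finset.range (N + 1), u n := by
    rw [Finset.mul_sum]
    exact (Finset.sum_le_sum fun n _ => hupp n).trans (Finset.sum_le_sum_of_subset hsub)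
  have hY' : Y ≤ ε⁻¹ * X ^ 2 := by
    rw [← ENNReal.div_eq_inv_mul, ENNReal.le_div_iff_mul_le (Or.inl hε0.ne') (Or.inl hεt),
      mul_comm]
    exact hY
  calc _ = ∑ m ∈ Finset.Icc 1 N, ∑ n ∈ Finset.Icc 1 N,
        ∫⁻ x, selectedCount p q k m x * selectedCount p q k n x ∂μ := by
        symm
        rw [Finset.sum_subset hsub fun m hm hm' => by simp [hzero m hm hm', hs0]]
        refine Finset.sum_congr rfl fun m _ => ?_
        exact Finset.sum_subset hsub fun n hn hn' => by simp [hzero n hn hn', hs0]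
    _ ≤ 9 * Y := by
        rw [Finset.mul_sum]
        refine Finset.sum_le_sum fun m _ => ?_
        rw [Finset.mul_sum]
        exact Finset.sum_le_sum fun n _ => hpair m n
    _ ≤ 9 * (ε⁻¹ * (8 * ∑ n ∈ Finset.range (N + 1), u n) ^ 2) := by
        gcongr
        exact hY'.trans (by gcongr)
    _ = 9 * (ε⁻¹ * 64) * (∑ n ∈ Finset.range (N + 1), u n) ^ 2 := by ring

lemma measure_frequently_eq_one_of_frequently_sum_le {q : ℕ → Prop} (hq : ∀ n, q n → ¬ p ∣ n)
    {k : ℕ → ℕ} (hk : Tendsto (fun n => (p : ℝ)⁻¹ ^ k n) atTop (𝓝 0))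
    (hdiv : ∑' n, ∫⁻ x, selectedCount p q k n x ∂μ = ∞)
    (hC : ∃ C : ℝ≥0∞, C ≠ ∞ ∧ ∃ᶠ N in atTop, ∑ m ∈ Finset.range N, ∑ n ∈ Finset.range N,
      ∫⁻ x, selectedCount p q k m x * selectedCount p q k n x ∂μ ≤
        C * (∑ n ∈ Finset.range N, ∫⁻ x, selectedCount p q k n x ∂μ) ^ 2) :
    μ {x | ∃ᶠ n in atTop, q n ∧ x ∈ padicApprox p n ((p : ℝ)⁻¹ ^ k n)} = 1 := by
  obtain ⟨C, hCt, hfreq⟩ := hC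
  have hpos := measure_frequently_ne_zero_pos μ (measurable_selectedCount q k)
    (lintegral_selectedCount_ne_top μ q k) hdiv hCt hfreq
  refine measure_frequently_padicApprox_eq_one μ hq (fun n => by positivity) hk ?_
  refine (hpos.trans_le (measure_mono fun x hx => ?_)).ne'
  refine Frequently.mono hx fun n hn => ?_
  by_cases h : q n
  · rw [selectedCount_of_pos h] at hn
    exact ⟨h, mem_padicApprox_of_padicCount_ne_zero (hq n h) hn⟩
  · rw [selectedCount_of_neg h] at hn
    exact absurd rfl hn

theorem measure_frequently_eq_one_of_tsum_eq_top (hQIA : QIAinftyHolds) {q : ℕ → Prop}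
    (hq : ∀ n, q n → ¬ p ∣ n) {k : ℕ → ℕ}
    (hk : Tendsto (fun n => (p : ℝ)⁻¹ ^ k n) atTop (𝓝 0))
    (hdiv : ∑' n, ∫⁻ x, selectedCount p q k n x ∂μ = ∞) :
    μ {x | ∃ᶠ n in atTop, q n ∧ x ∈ padicApprox p n ((p : ℝ)⁻¹ ^ k n)} = 1 := by
  set q₁ : ℕ → Prop := fun n => q n ∧ p ^ k n ≤ 8 * n with hq₁
  set q₂ : ℕ → Prop := fun n => q n ∧ 8 * n < p ^ k n with hq₂
  have hsplit : ∀ n, ∫⁻ x, selectedCount p q k n x ∂μ ≤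
      ∫⁻ x, selectedCount p q₁ k n x ∂μ + ∫⁻ x, selectedCount p q₂ k n x ∂μ := by
    intro n
    by_cases h : q n
    · rcases le_or_gt (p ^ k n) (8 * n) with h' | h'
      · rw [selectedCount_of_pos h, selectedCount_of_pos (q := q₁) ⟨h, h'⟩]
        exact le_self_add
      · rw [selectedCount_of_pos h, selectedCount_of_pos (q := q₂) ⟨h, h'⟩]
        exact le_add_self
    · simp [selectedCount_of_neg h]
  have hsum := ENNReal.tsum_le_tsum hsplit
  rw [hdiv, ENNReal.tsum_add, top_le_iff, ENNReal.add_eq_top] at hsum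
  refine le_antisymm prob_le_one ?_
  rcases hsum with h | h
  · rw [← measure_frequently_eq_one_of_frequently_sum_le μ (q := q₁) (fun n hn => hq n hn.1) hk h
      (frequently_sum_lintegral_le_of_overlap μ (fun n hn => hq n hn.1) (fun n hn => hn.2) h)]
    exact measure_mono fun x hx => Frequently.mono hx fun n hn => ⟨hn.1.1, hn.2⟩
  · rw [← measure_frequently_eq_one_of_frequently_sum_le μ (q := q₂) (fun n hn => hq n hn.1) hk h
      (frequently_sum_lintegral_le_of_disjoint μ hQIA (fun n hn => hq n hn.1)
        (fun n hn => hn.2) h)]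
    exact measure_mono fun x hx => Frequently.mono hx fun n hn => ⟨hn.1.1, hn.2⟩

end Divergence

section Main

open scoped ENNReal Topology
open Metric

lemma tendsto_inv_pow_ennreal {p : ℕ} (hp : p.Prime) :
    Tendsto (fun k : ℕ => (p : ℝ≥0∞)⁻¹ ^ k) atTop (𝓝 0) :=
  ENNReal.tendsto_pow_atTop_nhds_zero_of_lt_one
    (ENNReal.inv_lt_one.2 (by exact_mod_cast hp.one_lt))

lemma tendsto_inv_pow_of_le_sq {p : ℕ} (hp : p.Prime) {k : ℕ → ℕ} (hk : ∀ n, n ≤ (p ^ k n) ^ 2) :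
    Tendsto (fun n => (p : ℝ)⁻¹ ^ k n) atTop (𝓝 0) := by
  have hp0 : (0 : ℝ) < p := by exact_mod_cast hp.pos
  have h1 : Tendsto (fun n : ℕ => (Real.sqrt n)⁻¹) atTop (𝓝 0) :=
    tendsto_inv_atTop_zero.comp (Real.tendsto_sqrt_atTop.comp tendsto_natCast_atTop_atTop)
  refine tendsto_of_tendsto_of_tendsto_of_le_of_le' tendsto_const_nhds h1
    (Eventually.of_forall fun n => by positivity) ?_
  filter_upwards [eventually_gt_atTop 0] with n hn
  have hn' : (0 : ℝ) < n := by exact_mod_cast hn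
  rw [inv_pow]
  refine inv_anti₀ (Real.sqrt_pos.2 hn') (Real.sqrt_le_left (by positivity) |>.2 ?_)
  exact_mod_cast hk n

variable {p : ℕ} [Fact p.Prime]

lemma padicApprox_mono (p : ℕ) [Fact p.Prime] (n : ℕ) {r s : ℝ} (hrs : r ≤ s) :
    padicApprox p n r ⊆ padicApprox p n s :=
  fun _ ⟨a, ha, hx⟩ => ⟨a, ha, hx.trans hrs⟩

lemma padicE_eq_padicApprox (ψ : ℕ → ℝ) {n : ℕ} (hn : ¬ p ∣ n) :
    padicE p ψ n = padicApprox p n (ψ n) := by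
  have hn0 : (n : ℚ_[p]) ≠ 0 := by exact_mod_cast (pos_of_not_dvd hn).ne'
  have hnorm : ‖(n : ℚ_[p])‖ = 1 := by
    have := norm_natCast_eq_one (p := p) hn
    rwa [PadicInt.norm_def, PadicInt.coe_natCast] at this
  ext x
  simp only [padicE, padicApprox, Set.mem_ofPred_eq, mem_reducedNumerators, and_assoc]
  refine exists_congr fun a => and_congr_right fun _ => and_congr_right fun _ => ?_
  have h1 : ‖(n : ℤ_[p]) * x - (a : ℤ_[p])‖ = ‖(x : ℚ_[p]) - (a : ℚ_[p]) / (n : ℚ_[p])‖ := by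
    rw [PadicInt.norm_def]
    push_cast
    have h2 : (n : ℚ_[p]) * x - a = n * ((x : ℚ_[p]) - (a : ℚ_[p]) / (n : ℚ_[p])) := by
      field_simp
    rw [h2, norm_mul, hnorm, one_mul]
  rw [h1]

lemma padicE_eq_empty_or_univ (ψ : ℕ → ℝ) {n : ℕ} (hn : p ∣ n) :
    padicE p ψ n = ∅ ∨ padicE p ψ n = Set.univ := by
  rw [or_iff_not_imp_left, ← Ne, ← Set.nonempty_iff_ne_empty]
  rintro ⟨x, a, ha, hgcd, hx⟩
  refine Set.eq_univ_of_forall fun y => ⟨a, ha, hgcd, ?_⟩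
  have hpp : p.Prime := Fact.out
  have hp1 : (1 : ℝ) < p := by exact_mod_cast hpp.one_lt
  rcases Nat.eq_zero_or_pos n with rfl | hn0
  · have : a = 0 := by simpa using ha
    simp [this] at hgcd
  have hpa : ¬ (p : ℤ) ∣ a := fun h => by
    have h1 : (p : ℤ) ∣ (Int.gcd a n : ℤ) := Int.dvd_coe_gcd h (by exact_mod_cast hn)
    rw [hgcd] at h1
    exact hpp.one_lt.ne' (by exact_mod_cast Int.eq_one_of_dvd_one (by positivity) h1)
  have hna : ‖(a : ℚ_[p])‖ = 1 := by
    refine le_antisymm (Padic.norm_int_le_one a) (not_lt.1 fun h => hpa ?_)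
    exact Padic.norm_intCast_lt_one_iff.1 h
  have hnn : ‖(n : ℚ_[p])‖ < 1 := by
    have := (Padic.norm_intCast_lt_one_iff (p := p) (k := (n : ℤ))).2 (by exact_mod_cast hn)
    exact_mod_cast this
  have hnn0 : 0 < ‖(n : ℚ_[p])‖ := norm_pos_iff.2 (by exact_mod_cast hn0.ne')
  have hq : 1 < ‖(a : ℚ_[p]) / (n : ℚ_[p])‖ := by
    rw [norm_div, hna]
    exact (one_lt_div hnn0).2 hnn
  have hle : ∀ z : ℤ_[p], ‖(z : ℚ_[p])‖ ≤ 1 := fun z => PadicInt.norm_le_one z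
  have hval : ∀ z : ℤ_[p], ‖(z : ℚ_[p]) - (a : ℚ_[p]) / (n : ℚ_[p])‖ =
      ‖(a : ℚ_[p]) / (n : ℚ_[p])‖ := fun z => by
    rw [sub_eq_add_neg, Padic.add_eq_max_of_ne, norm_neg,
      max_eq_right ((hle z).trans hq.le)]
    rw [norm_neg]
    exact ((hle z).trans_lt hq).ne
  rw [hval] at hx ⊢
  exact hx

variable [MeasurableSpace ℤ_[p]] [BorelSpace ℤ_[p]]
variable (μ : Measure ℤ_[p]) [μ.IsAddHaarMeasure] [IsProbabilityMeasure μ]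

lemma measure_padicApprox_inv_pow_le {n : ℕ} (hn : ¬ p ∣ n) (k : ℕ) :
    μ (padicApprox p n ((p : ℝ)⁻¹ ^ k)) ≤
      (reducedNumerators n).card * (p : ℝ≥0∞)⁻¹ ^ k := by
  have hsub : padicApprox p n ((p : ℝ)⁻¹ ^ k) ⊆ ⋃ a ∈ reducedNumerators n,
      closedBall ((a : ℤ_[p]) * (n : ℤ_[p]).inv) ((p : ℝ)⁻¹ ^ k) := by
    rintro x ⟨a, ha, hx⟩
    refine Set.mem_biUnion (Finset.mem_coe.2 ha) ?_
    rwa [mem_closedBall, ← norm_natCast_mul_sub hn]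
  refine (measure_mono hsub).trans ((measure_biUnion_finset_le _ _).trans ?_)
  rw [← nsmul_eq_mul]
  exact Finset.sum_le_card_nsmul _ _ _ fun a _ => (measure_closedBall_inv_pow μ _ k).le

lemma measure_padicApprox_zero {n : ℕ} (hn : ¬ p ∣ n) : μ (padicApprox p n 0) = 0 := by
  have h1 : Tendsto (fun k : ℕ => ((reducedNumerators n).card : ℝ≥0∞) * (p : ℝ≥0∞)⁻¹ ^ k) atTop
      (𝓝 (((reducedNumerators n).card : ℝ≥0∞) * 0)) :=
    ENNReal.Tendsto.const_mul (tendsto_inv_pow_ennreal Fact.out)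
      (Or.inr (ENNReal.natCast_ne_top _))
  rw [mul_zero] at h1
  refine le_antisymm (ge_of_tendsto' h1 fun k => ?_) zero_le
  exact (measure_mono (padicApprox_mono p n (by positivity))).trans
    (measure_padicApprox_inv_pow_le μ hn k)

lemma exists_inv_pow_le_and_measure_le {n : ℕ} (hn : ¬ p ∣ n) {r : ℝ} (hr : 0 < r) :
    ∃ k : ℕ, n ≤ (p ^ k) ^ 2 ∧ (p : ℝ)⁻¹ ^ k ≤ r ∧
      μ (padicApprox p n r) ≤ 2 * p * ((reducedNumerators n).card * (p : ℝ≥0∞)⁻¹ ^ k) := by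
  classical
  have hpp : p.Prime := Fact.out
  have hp0 : (0 : ℝ) < p := by exact_mod_cast hpp.pos
  have hpE0 : (p : ℝ≥0∞) ≠ 0 := by exact_mod_cast hpp.ne_zero
  have hinv : (p : ℝ)⁻¹ < 1 := inv_lt_one_of_one_lt₀ (by exact_mod_cast hpp.one_lt)
  have hn0 := pos_of_not_dvd hn
  have hφ : 0 < n.totient := Nat.totient_pos.2 hn0
  have hcard : n.totient ≤ (reducedNumerators n).card := totient_le_card_reducedNumerators
  have hshift : ∀ j : ℕ, (p : ℝ≥0∞) * (p : ℝ≥0∞)⁻¹ ^ (j + 1) = (p : ℝ≥0∞)⁻¹ ^ j := fun j => by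
    rw [pow_succ, mul_comm, mul_assoc, ENNReal.inv_mul_cancel hpE0 (ENNReal.natCast_ne_top p),
      mul_one]
  have hex1 : ∃ k : ℕ, (p : ℝ)⁻¹ ^ k ≤ r :=
    (exists_pow_lt_of_lt_one hr hinv).imp fun _ h => h.le
  have hex2 : ∃ k : ℕ, n ≤ (p ^ k) ^ 2 := ⟨n, (Nat.lt_pow_self hpp.one_lt).le.trans
    (Nat.le_self_pow two_ne_zero _)⟩
  rcases le_or_gt (Nat.find hex2) (Nat.find hex1) with h | h
  · refine ⟨Nat.find hex1, (Nat.find_spec hex2).trans ?_, Nat.find_spec hex1, ?_⟩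
    · exact Nat.pow_le_pow_left (Nat.pow_le_pow_right hpp.pos h) 2
    · rcases hk : Nat.find hex1 with _ | j
      · refine prob_le_one.trans ?_
        have h1 : 1 ≤ 2 * p * (reducedNumerators n).card :=
          Nat.one_le_iff_ne_zero.2 (by
            have := hpp.pos
            have := hφ.trans_le hcard
            positivity)
        rw [pow_zero, mul_one]
        exact_mod_cast h1
      · have hlt : r < (p : ℝ)⁻¹ ^ j := not_le.1 (Nat.find_min hex1 (by omega))
        refine (measure_mono (padicApprox_mono p n hlt.le)).trans
          ((measure_padicApprox_inv_pow_le μ hn j).trans ?_)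
        rw [← hshift j]
        calc _ = 1 * ((p : ℝ≥0∞) * ((reducedNumerators n).card * (p : ℝ≥0∞)⁻¹ ^ (j + 1))) := by
              ring
          _ ≤ 2 * ((p : ℝ≥0∞) * ((reducedNumerators n).card * (p : ℝ≥0∞)⁻¹ ^ (j + 1))) := by
              gcongr
              norm_num
          _ = _ := by ring
  · refine ⟨Nat.find hex2, Nat.find_spec hex2, ?_, ?_⟩
    · exact (pow_le_pow_of_le_one (by positivity) hinv.le h.le).trans (Nat.find_spec hex1)
    · rcases hk : Nat.find hex2 with _ | j
      · omega
      · have hlt : (p ^ j) ^ 2 < n := not_le.1 (Nat.find_min hex2 (by omega))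
        have h2 : p ^ j ≤ 2 * (reducedNumerators n).card := by
          have h3 : (p ^ j) ^ 2 < (2 * n.totient) ^ 2 := by
            have := le_two_mul_totient_sq n
            nlinarith
          have h4 := lt_of_pow_lt_pow_left₀ 2 (by positivity) h3
          omega
        have h5 : ((p : ℝ≥0∞)) ^ j ≤ 2 * (reducedNumerators n).card := by exact_mod_cast h2
        refine prob_le_one.trans ?_
        calc (1 : ℝ≥0∞) = (p : ℝ≥0∞) ^ j * (p : ℝ≥0∞)⁻¹ ^ j := by
              rw [← mul_pow, ENNReal.mul_inv_cancel hpE0 (ENNReal.natCast_ne_top p), one_pow]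
          _ ≤ 2 * (reducedNumerators n).card * (p : ℝ≥0∞)⁻¹ ^ j := by gcongr
          _ = 2 * (reducedNumerators n).card * ((p : ℝ≥0∞) * (p : ℝ≥0∞)⁻¹ ^ (j + 1)) := by
              rw [hshift]
          _ = _ := by ring

theorem measure_padicW_eq_one (hQIA : QIAinftyHolds) {ψ : ℕ → ℝ} (hψ : ∀ n, 0 ≤ ψ n)
    (hdiv : ∑' n, μ (padicE p ψ n) = ∞) : μ (padicW p ψ) = 1 := by
  classical
  by_cases hinf : {n | p ∣ n ∧ padicE p ψ n = Set.univ}.Infinite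
  · have hW : padicW p ψ = Set.univ := by
      refine Set.eq_univ_of_forall fun x => hinf.mono fun n hn => ?_
      simp only [Set.mem_ofPred_eq] at hn ⊢
      rw [hn.2]
      exact Set.mem_univ x
    rw [hW, measure_univ]
  rw [Set.not_infinite] at hinf
  set q : ℕ → Prop := fun n => ¬ p ∣ n ∧ 0 < ψ n with hq
  have hlevel : ∀ n, ∃ k : ℕ, n ≤ (p ^ k) ^ 2 ∧ (q n → (p : ℝ)⁻¹ ^ k ≤ ψ n ∧
      μ (padicE p ψ n) ≤ 2 * p * ((reducedNumerators n).card * (p : ℝ≥0∞)⁻¹ ^ k)) := by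
    intro n
    by_cases h : q n
    · obtain ⟨k, h1, h2, h3⟩ := exists_inv_pow_le_and_measure_le μ h.1 h.2
      rw [← padicE_eq_padicApprox ψ h.1] at h3
      exact ⟨k, h1, fun _ => ⟨h2, h3⟩⟩
    · exact ⟨n, (Nat.lt_pow_self (Fact.out : p.Prime).one_lt).le.trans
        (Nat.le_self_pow two_ne_zero _), fun h' => absurd h' h⟩
  choose k hk1 hk2 using hlevel
  have hbound : ∀ n, μ (padicE p ψ n) ≤
      (if n ∈ hinf.toFinset then 1 else 0) + 2 * p * ∫⁻ x, selectedCount p q k n x ∂μ := by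
    intro n
    by_cases hpn : p ∣ n
    · rcases padicE_eq_empty_or_univ ψ hpn with h | h
      · simp [h]
      · have hmem : n ∈ hinf.toFinset := hinf.mem_toFinset.2 ⟨hpn, h⟩
        rw [if_pos hmem]
        exact prob_le_one.trans le_self_add
    · rcases (hψ n).eq_or_lt with h | h
      · rw [padicE_eq_padicApprox ψ hpn, ← h, measure_padicApprox_zero μ hpn]
        exact zero_le
      · have hqn : q n := ⟨hpn, h⟩
        rw [selectedCount_of_pos hqn, lintegral_padicCount]
        exact (hk2 n hqn).2.trans le_add_self
  have hsum : ∑' n, ∫⁻ x, selectedCount p q k n x ∂μ = ∞ := by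
    by_contra hne
    have h1 := ENNReal.tsum_le_tsum hbound
    rw [hdiv, ENNReal.tsum_add, ENNReal.tsum_mul_left, top_le_iff] at h1
    refine ENNReal.add_ne_top.2 ⟨?_, ?_⟩ h1
    · rw [tsum_eq_sum (s := hinf.toFinset) fun n hn => if_neg hn]
      refine ENNReal.sum_ne_top.2 fun n _ => ?_
      split_ifs
      · exact ENNReal.one_ne_top
    · exact ENNReal.mul_ne_top (ENNReal.mul_ne_top (by norm_num) (ENNReal.natCast_ne_top p)) hne
  have hone := measure_frequently_eq_one_of_tsum_eq_top μ hQIA (q := q) (fun n hn => hn.1)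
    (tendsto_inv_pow_of_le_sq Fact.out hk1) hsum
  refine le_antisymm prob_le_one ?_
  rw [← hone]
  refine measure_mono fun x hx => Nat.frequently_atTop_iff_infinite.1 (Frequently.mono hx ?_)
  rintro n ⟨hqn, hxn⟩
  rw [padicE_eq_padicApprox ψ hqn.1]
  exact padicApprox_mono p n (hk2 n hqn).1 hxn

end Main

/-- **Theorem 3 (Haynes).** If `(QIA_∞)` holds then the `p`-adic Duffin-Schaeffer
Conjecture is true for every prime `p`: for every non-negative `ψ`, the set `W_p(ψ)`
has Haar measure `1` if `Σ μ_p(E_n(ψ)) = ∞`, and Haar measure `0` otherwise. -/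
theorem stmt2 (hQIA : QIAinftyHolds)
    (p : ℕ) [Fact p.Prime] [MeasurableSpace ℤ_[p]] [BorelSpace ℤ_[p]]
    (μ : Measure ℤ_[p]) [μ.IsAddHaarMeasure] [IsProbabilityMeasure μ]
    (ψ : ℕ → ℝ) (hψ : ∀ n, 0 ≤ ψ n) :
    ((∑' n : ℕ, μ (padicE p ψ n)) = ⊤ → μ (padicW p ψ) = 1) ∧
      ((∑' n : ℕ, μ (padicE p ψ n)) ≠ ⊤ → μ (padicW p ψ) = 0) := by
  refine ⟨measure_padicW_eq_one μ hQIA hψ, fun h => ?_⟩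
  rw [← measure_setOfPred_frequently_eq_zero h]
  congr 1
  ext x
  exact Nat.frequently_atTop_iff_infinite.symm
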